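/- arXiv:1611.05404 — 9 statements merged into one kernel-verified Lean document; each statement's English description precedes it below -/
import Mathlib

section
/- Let n ≥ 1, let M be an n×n integer matrix with det M ≠ 0, let L be a hyper-L of M, and let t ≥ 1 be an integer. Then any two distinct elements x, y of the t-dilate tL satisfy x ≢ y (mod tM). -/
/-- Congruence modulo the lattice `M·ℤⁿ`: `a ≡ b (mod M)` iff `a - b = M·λ` for some `λ ∈ ℤⁿ`. -/
def MEq {n : ℕ} (M : Matrix (Fin n) (Fin n) ℤ) (a b : Fin n → ℤ) : Prop :=
  ∃ l : Fin n → ℤ, a - b = M.mulVec l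

/-- View a vector of naturals as a vector of integers. -/
def ivec {n : ℕ} (a : Fin n → ℕ) : Fin n → ℤ := fun i => (a i : ℤ)

/-- The ℓ¹-norm of a nonnegative integer vector. -/
def nnorm {n : ℕ} (a : Fin n → ℕ) : ℕ := ∑ i, a i

/-- A hyper-L of `M`: a finite lower set of `ℕⁿ` whose reduction map to `ℤⁿ/Mℤⁿ`
is a bijection (every `z ∈ ℤⁿ` is congruent mod `M` to exactly one element of `L`). -/
def IsHyperL {n : ℕ} (M : Matrix (Fin n) (Fin n) ℤ) (L : Set (Fin n → ℕ)) : Prop :=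
  L.Finite ∧ IsLowerSet L ∧ ∀ z : Fin n → ℤ, ∃! a : Fin n → ℕ, a ∈ L ∧ MEq M (ivec a) z

/-- The `t`-dilate of a set `L ⊆ ℕⁿ`:
`tL = {t·a + α : a ∈ L, α ∈ ℕⁿ, αᵢ ≤ t - 1 for all i}`. -/
def dilate {n : ℕ} (t : ℕ) (L : Set (Fin n → ℕ)) : Set (Fin n → ℕ) :=
  {x | ∃ a ∈ L, ∃ α : Fin n → ℕ, (∀ i, α i ≤ t - 1) ∧ x = fun i => t * a i + α i}

/-- The diameter of a set `L ⊆ ℕⁿ`: the maximum ℓ¹-norm of its elements. -/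
noncomputable def kdiam {n : ℕ} (L : Set (Fin n → ℕ)) : ℕ := sSup (nnorm '' L)

/-- The distance from `0` to (the class of) `z` in the Cayley digraph `G_M`:
the minimum ℓ¹-norm of a nonnegative vector congruent to `z` mod `M`. -/
noncomputable def distG {n : ℕ} (M : Matrix (Fin n) (Fin n) ℤ) (z : Fin n → ℤ) : ℕ :=
  sInf {m | ∃ x : Fin n → ℕ, MEq M (ivec x) z ∧ m = nnorm x}

/-- The diameter of the Cayley digraph `G_M = Cay(ℤⁿ/Mℤⁿ, {e₁,…,eₙ})`. -/
noncomputable def kG {n : ℕ} (M : Matrix (Fin n) (Fin n) ℤ) : ℕ :=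
  sSup (Set.range fun z : Fin n → ℤ => distG M z)

/-- A minimum distance diagram of `M`: a hyper-L each of whose elements has
minimum ℓ¹-norm within its congruence class mod `M`. -/
def IsMDD {n : ℕ} (M : Matrix (Fin n) (Fin n) ℤ) (H : Set (Fin n → ℕ)) : Prop :=
  IsHyperL M H ∧ ∀ a ∈ H, ∀ x : Fin n → ℕ, MEq M (ivec x) (ivec a) → nnorm a ≤ nnorm x

/-- Lemma 5: if `L` is a hyper-L of `M` and `t ≥ 1`, then any two
distinct elements of the `t`-dilate `tL` are incongruent modulo `tM`. -/
theorem dilate_not_congruent {n : ℕ} (hn : 1 ≤ n) (M : Matrix (Fin n) (Fin n) ℤ)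
    (hM : M.det ≠ 0) (L : Set (Fin n → ℕ)) (hL : IsHyperL M L) (t : ℕ) (ht : 1 ≤ t)
    (x y : Fin n → ℕ) (hx : x ∈ dilate t L) (hy : y ∈ dilate t L) (hxy : x ≠ y) :
    ¬ MEq ((t : ℤ) • M) (ivec x) (ivec y) := by
  rintro ⟨l, hl⟩
  obtain ⟨a, ha, α, hα, rfl⟩ := hx
  obtain ⟨b, hb, β, hβ, rfl⟩ := hy
  have hcoord (i : Fin n) :
      ((t : ℤ) * a i + α i) - (t * b i + β i) = t * M.mulVec l i := by
    rw [Matrix.smul_mulVec] at hl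
    simpa [ivec] using congrFun hl i
  have hαβ (i : Fin n) : α i = β i := by
    have hmod : α i ≡ β i [MOD t] := by
      refine (Nat.modEq_iff_dvd.2 ⟨a i - b i - M.mulVec l i, ?_⟩)
      linear_combination -hcoord i
    have hαi := hα i
    have hβi := hβ i
    exact hmod.eq_of_lt_of_lt (by omega) (by omega)
  have hab : MEq M (ivec a) (ivec b) := by
    refine ⟨l, funext fun i => ?_⟩
    have ht0 : (t : ℤ) ≠ 0 := by positivity
    have hi := hcoord i
    rw [hαβ i] at hi
    refine mul_left_cancel₀ ht0 ?_
    simp only [ivec, Pi.sub_apply]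
    linear_combination hi
  have hbb : MEq M (ivec b) (ivec b) := ⟨0, by simp⟩
  have heq : a = b := (hL.2.2 (ivec b)).unique ⟨ha, hab⟩ ⟨hb, hbb⟩
  exact hxy (funext fun i => by rw [heq, hαβ i])
end

section
/- Let n ≥ 1, let M be an n×n integer matrix with det M ≠ 0, let L ⊆ ℕⁿ be a finite lower set, and let t ≥ 1 be an integer. Then L is a hyper-L of M if and only if the t-dilate tL is a hyper-L of tM. -/
theorem mem_dilate_iff {n t : ℕ} (ht : 1 ≤ t) {L : Set (Fin n → ℕ)} {x : Fin n → ℕ} :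
    x ∈ dilate t L ↔ (fun i => x i / t) ∈ L := by
  constructor
  · rintro ⟨a, ha, α, hα, rfl⟩
    convert ha using 1
    funext i
    have := hα i
    rw [Nat.mul_add_div ht, Nat.div_eq_of_lt (by omega), add_zero]
  · intro h
    refine ⟨_, h, fun i => x i % t, fun i => ?_, ?_⟩
    · exact Nat.le_sub_one_of_lt (Nat.mod_lt _ ht)
    · funext i
      exact (Nat.div_add_mod _ _).symm

theorem finite_dilate {n t : ℕ} {L : Set (Fin n → ℕ)} (hL : L.Finite) :
    (dilate t L).Finite := by
  refine (hL.image2 (fun a α i => t * a i + α i)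
    (Set.finite_Iic (fun _ : Fin n => t - 1))).subset ?_
  rintro x ⟨a, ha, α, hα, rfl⟩
  exact ⟨a, ha, α, hα, rfl⟩

theorem isLowerSet_dilate {n t : ℕ} (ht : 1 ≤ t) {L : Set (Fin n → ℕ)} (hL : IsLowerSet L) :
    IsLowerSet (dilate t L) := by
  intro x y hyx hx
  rw [mem_dilate_iff ht] at hx ⊢
  exact hL (fun i => Nat.div_le_div_right (hyx i)) hx

/-- Congruence modulo `tM` is congruence of the quotients by `t` modulo `M` together with
equality of the remainders. -/
theorem mEq_smul_iff {n t : ℕ} (ht : 1 ≤ t) {M : Matrix (Fin n) (Fin n) ℤ} {a b : Fin n → ℤ} :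
    MEq ((t : ℤ) • M) a b ↔
      MEq M (fun i => a i / t) (fun i => b i / t) ∧ ∀ i, a i % t = b i % t := by
  have ht0 : (t : ℤ) ≠ 0 := by positivity
  constructor
  · rintro ⟨l, hl⟩
    have h (i) : a i = b i + t * M.mulVec l i := by
      have := congrFun hl i
      simp only [Matrix.smul_mulVec, Pi.sub_apply, Pi.smul_apply, smul_eq_mul] at this
      linarith
    refine ⟨⟨l, funext fun i => ?_⟩, fun i => ?_⟩
    · simp [h i, Int.add_mul_ediv_left _ _ ht0]
    · simp [h i]
  · rintro ⟨⟨l, hl⟩, hmod⟩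
    refine ⟨l, funext fun i => ?_⟩
    have hdiv := congrFun hl i
    simp only [Matrix.smul_mulVec, Pi.sub_apply, Pi.smul_apply, smul_eq_mul] at hdiv ⊢
    linear_combination (t : ℤ) * hdiv - Int.mul_ediv_add_emod (a i) t
      + Int.mul_ediv_add_emod (b i) t + hmod i

theorem mEq_smul_ivec_iff {n t : ℕ} (ht : 1 ≤ t) {M : Matrix (Fin n) (Fin n) ℤ}
    {x : Fin n → ℕ} {z : Fin n → ℤ} :
    MEq ((t : ℤ) • M) (ivec x) z ↔
      MEq M (ivec fun i => x i / t) (fun i => z i / t) ∧ ∀ i, (x i : ℤ) % t = z i % t :=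
  mEq_smul_iff ht

/-- Theorem, part (a): a finite lower set `L ⊆ ℕⁿ` is a hyper-L of `M`
iff its `t`-dilate is a hyper-L of `tM`. -/
theorem isHyperL_iff_dilate {n : ℕ} (hn : 1 ≤ n) (M : Matrix (Fin n) (Fin n) ℤ)
    (hM : M.det ≠ 0) (L : Set (Fin n → ℕ)) (hfin : L.Finite) (hlow : IsLowerSet L)
    (t : ℕ) (ht : 1 ≤ t) :
    IsHyperL M L ↔ IsHyperL ((t : ℤ) • M) (dilate t L) := by
  constructor
  · rintro ⟨-, -, h⟩
    refine ⟨finite_dilate hfin, isLowerSet_dilate ht hlow, fun z => ?_⟩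
    obtain ⟨a, ⟨haL, haz⟩, huniq⟩ := h fun i => z i / t
    have hr (i) : (((z i % t).toNat : ℕ) : ℤ) = z i % t :=
      Int.toNat_of_nonneg (Int.emod_nonneg _ (by positivity))
    have hlt (i) : (z i % t).toNat < t := by
      have := Int.emod_lt_of_pos (z i) (by positivity : (0 : ℤ) < t)
      omega
    have hdiv : (fun i => (t * a i + (z i % t).toNat) / t) = a := by
      funext i
      rw [Nat.mul_add_div ht, Nat.div_eq_of_lt (hlt i), add_zero]
    refine ⟨fun i => t * a i + (z i % t).toNat, ⟨?_, ?_⟩, ?_⟩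
    · rwa [mem_dilate_iff ht, hdiv]
    · rw [mEq_smul_ivec_iff ht, hdiv]
      refine ⟨haz, fun i => ?_⟩
      rw [Nat.cast_add, hr]
      simp
    · rintro y ⟨hyL, hyz⟩
      rw [mem_dilate_iff ht] at hyL
      rw [mEq_smul_ivec_iff ht] at hyz
      funext i
      have hq : y i / t = a i := congrFun (huniq _ ⟨hyL, hyz.1⟩) i
      have hm : y i % t = (z i % t).toNat := by
        have := hyz.2 i
        rw [← hr i] at this
        exact_mod_cast this
      rw [← hq, ← hm, Nat.div_add_mod]
  · rintro ⟨-, -, h⟩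
    refine ⟨hfin, hlow, fun z => ?_⟩
    have ht0 : (t : ℤ) ≠ 0 := by positivity
    obtain ⟨x, ⟨hxL, hxz⟩, huniq⟩ := h fun i => t * z i
    rw [mem_dilate_iff ht] at hxL
    simp only [mEq_smul_ivec_iff ht, Int.mul_ediv_cancel_left _ ht0] at hxz huniq
    refine ⟨_, ⟨hxL, hxz.1⟩, ?_⟩
    rintro b ⟨hbL, hbz⟩
    have hdiv : (fun i => t * b i / t) = b := funext fun i => Nat.mul_div_cancel_left _ ht
    have hb := huniq (fun i => t * b i)
      ⟨by rwa [mem_dilate_iff ht, hdiv], by rwa [hdiv], fun i => by simp⟩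
    rw [← hb, hdiv]
end

section
/- Let n ≥ 1, let M be an n×n integer matrix with det M ≠ 0, and let t ≥ 1 be an integer. Then the diameters of the Cayley digraphs G_M and G_{tM} satisfy k(G_{tM}) = t·(k(G_M) + n) − n. -/
/-- The vector reduced modulo `det M` coordinatewise represents its class modulo `M`. -/
lemma exists_MEq_nnorm_le {n : ℕ} (M : Matrix (Fin n) (Fin n) ℤ) (hM : M.det ≠ 0)
    (z : Fin n → ℤ) :
    ∃ x : Fin n → ℕ, MEq M (ivec x) z ∧ nnorm x ≤ n * M.det.natAbs := by
  have hx (i : Fin n) : (((z i % M.det).toNat : ℕ) : ℤ) = z i % M.det :=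
    Int.toNat_of_nonneg (Int.emod_nonneg _ hM)
  refine ⟨fun i => (z i % M.det).toNat, ⟨M.adjugate.mulVec fun i => -(z i / M.det), ?_⟩, ?_⟩
  · rw [Matrix.mulVec_mulVec, Matrix.mul_adjugate, Matrix.smul_mulVec, Matrix.one_mulVec]
    funext i
    simp only [ivec, Pi.sub_apply, Pi.smul_apply, smul_eq_mul, hx]
    linarith [Int.emod_add_mul_ediv (z i) M.det]
  · have hle (i : Fin n) : (z i % M.det).toNat ≤ M.det.natAbs := by
      have := Int.abs_eq_natAbs M.det ▸ Int.emod_lt_abs (z i) hM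
      omega
    simpa [nnorm] using Finset.sum_le_sum fun i (_ : i ∈ Finset.univ) => hle i

lemma distG_le_nnorm {n : ℕ} {M : Matrix (Fin n) (Fin n) ℤ} {z : Fin n → ℤ} {x : Fin n → ℕ}
    (hx : MEq M (ivec x) z) : distG M z ≤ nnorm x :=
  Nat.sInf_le ⟨x, hx, rfl⟩

lemma exists_nnorm_eq_distG {n : ℕ} (M : Matrix (Fin n) (Fin n) ℤ) (hM : M.det ≠ 0)
    (z : Fin n → ℤ) : ∃ x : Fin n → ℕ, MEq M (ivec x) z ∧ nnorm x = distG M z := by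
  obtain ⟨x, hx, -⟩ := exists_MEq_nnorm_le M hM z
  obtain ⟨y, hy, h⟩ := Nat.sInf_mem
    (s := {m | ∃ x : Fin n → ℕ, MEq M (ivec x) z ∧ m = nnorm x}) ⟨_, x, hx, rfl⟩
  exact ⟨y, hy, h.symm⟩

lemma distG_le_kG {n : ℕ} (M : Matrix (Fin n) (Fin n) ℤ) (hM : M.det ≠ 0) (z : Fin n → ℤ) :
    distG M z ≤ kG M := by
  refine le_csSup ⟨n * M.det.natAbs, ?_⟩ ⟨z, rfl⟩
  rintro _ ⟨w, rfl⟩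
  obtain ⟨x, hx, hle⟩ := exists_MEq_nnorm_le M hM w
  exact (distG_le_nnorm hx).trans hle

lemma kG_le {n : ℕ} {M : Matrix (Fin n) (Fin n) ℤ} {k : ℕ} (h : ∀ z, distG M z ≤ k) :
    kG M ≤ k :=
  csSup_le (Set.range_nonempty _) (by rintro _ ⟨z, rfl⟩; exact h z)

lemma exists_distG_eq_kG {n : ℕ} (M : Matrix (Fin n) (Fin n) ℤ) (hM : M.det ≠ 0) :
    ∃ z, distG M z = kG M :=
  Nat.sSup_mem (Set.range_nonempty _)
    ⟨kG M, by rintro _ ⟨z, rfl⟩; exact distG_le_kG M hM z⟩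

lemma det_natCast_smul_ne_zero {n : ℕ} {M : Matrix (Fin n) (Fin n) ℤ} (hM : M.det ≠ 0)
    {t : ℕ} (ht : 1 ≤ t) : ((t : ℤ) • M).det ≠ 0 := by
  rw [Matrix.det_smul]
  exact mul_ne_zero (pow_ne_zero _ (by omega)) hM

lemma nnorm_mul_add {n : ℕ} (t : ℕ) (y α : Fin n → ℕ) :
    nnorm (fun i => t * y i + α i) = t * nnorm y + nnorm α := by
  simp [nnorm, Finset.sum_add_distrib, Finset.mul_sum]

/-- Distances in `G_{tM}` in terms of distances in `G_M`, via coordinatewise division by `t`. -/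
lemma distG_smul {n : ℕ} (M : Matrix (Fin n) (Fin n) ℤ) (hM : M.det ≠ 0) {t : ℕ}
    (ht : 1 ≤ t) (a : Fin n → ℤ) (α : Fin n → ℕ) (hα : ∀ i, α i < t) :
    distG ((t : ℤ) • M) (fun i => t * a i + α i) = t * distG M a + nnorm α := by
  have ht' : (t : ℤ) ≠ 0 := by omega
  apply le_antisymm
  · obtain ⟨y, ⟨l, hl⟩, hy⟩ := exists_nnorm_eq_distG M hM a
    rw [← hy, ← nnorm_mul_add]
    refine distG_le_nnorm ⟨l, ?_⟩
    rw [Matrix.smul_mulVec, ← hl]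
    funext i
    simp only [ivec, Pi.sub_apply, Pi.smul_apply, smul_eq_mul]
    push_cast
    ring
  · obtain ⟨x, ⟨l, hl⟩, hx⟩ := exists_nnorm_eq_distG _ (det_natCast_smul_ne_zero hM ht)
      (fun i => t * a i + α i)
    have hxi (i : Fin n) : (x i : ℤ) = α i + t * (a i + M.mulVec l i) := by
      have := congrFun hl i
      simp only [ivec, Matrix.smul_mulVec, Pi.sub_apply, Pi.smul_apply, smul_eq_mul] at this
      linarith
    have hdiv (i : Fin n) : ((x i / t : ℕ) : ℤ) = a i + M.mulVec l i := by
      rw [Int.natCast_ediv, hxi, Int.add_mul_ediv_left _ _ ht',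
        Int.ediv_eq_zero_of_lt (by omega) (by exact_mod_cast hα i), zero_add]
    have hxeq : x = fun i => t * (x i / t) + α i := by
      funext i
      zify
      rw [← Int.natCast_ediv, hdiv, hxi]
      ring
    rw [← hx, hxeq, nnorm_mul_add t (fun i => x i / t)]
    gcongr
    refine distG_le_nnorm ⟨l, ?_⟩
    funext i
    simp only [ivec, Pi.sub_apply, hdiv]
    ring

/-- Theorem, part (d): the diameters of the Cayley digraphs `G_M` and
`G_{tM}` satisfy `k(G_{tM}) = t·(k(G_M) + n) - n`. -/
theorem kG_smul {n : ℕ} (hn : 1 ≤ n) (M : Matrix (Fin n) (Fin n) ℤ)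
    (hM : M.det ≠ 0) (t : ℕ) (ht : 1 ≤ t) :
    kG ((t : ℤ) • M) = t * (kG M + n) - n := by
  have hrhs : t * (kG M + n) - n = t * kG M + n * (t - 1) := by
    obtain ⟨s, rfl⟩ := Nat.exists_eq_add_of_le' ht
    rw [Nat.add_sub_cancel, Nat.sub_eq_iff_eq_add (by nlinarith)]
    ring
  rw [hrhs]
  apply le_antisymm
  · refine kG_le fun z => ?_
    have ht' : (0 : ℤ) < t := by omega
    have hmod (i : Fin n) : (((z i % t).toNat : ℕ) : ℤ) = z i % t :=
      Int.toNat_of_nonneg (Int.emod_nonneg _ ht'.ne')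
    have hlt (i : Fin n) : (z i % t).toNat < t := by
      have := Int.emod_lt_of_pos (z i) ht'
      omega
    have hz : z = fun i => t * (z i / t) + ((z i % t).toNat : ℤ) := by
      funext i
      rw [hmod, Int.mul_ediv_add_emod]
    rw [hz, distG_smul M hM ht (fun i => z i / t) (fun i => (z i % t).toNat) hlt]
    gcongr
    · exact distG_le_kG M hM _
    · simpa [nnorm] using
        Finset.sum_le_sum fun i (_ : i ∈ Finset.univ) => Nat.le_sub_one_of_lt (hlt i)
  · obtain ⟨a, ha⟩ := exists_distG_eq_kG M hM
    have h := distG_smul M hM ht a (fun _ => t - 1) fun _ => by omega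
    rw [ha, show nnorm (fun _ : Fin n => t - 1) = n * (t - 1) by simp [nnorm]] at h
    rw [← h]
    exact distG_le_kG _ (det_natCast_smul_ne_zero hM ht) _
end

section
/- For every integer x ≥ 1, set N = 84x³ + 74x² + 18x + 1 and consider the elements g₁ = −(21x² + 15x + 2), g₂ = 21x² + 8x, g₃ = −(42x² + 23x + 3) of ℤ/Nℤ. Then every element of ℤ/Nℤ can be written as a₁·g₁ + a₂·g₂ + a₃·g₃ with a₁, a₂, a₃ ∈ ℕ and a₁ + a₂ + a₃ ≤ 10x + 2; that is, the Cayley digraph Cay(ℤ/Nℤ, {g₁, g₂, g₃}) has diameter at most 10x + 2. -/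
/-- A coefficient triple of minimal total weight among all representations of an element does not
dominate a relation of positive total weight. -/
lemma lt_of_minimal_of_relation {N : ℕ} {x₁ x₂ x₃ : ℤ} {g : ZMod N} {a b c : ℕ}
    (hg : g = ((a * x₁ + b * x₂ + c * x₃ : ℤ) : ZMod N))
    (hmin : ∀ a' b' c' : ℕ, g = ((a' * x₁ + b' * x₂ + c' * x₃ : ℤ) : ZMod N) →
      a + b + c ≤ a' + b' + c')
    (d₁ d₂ d₃ k : ℤ) (hd : d₁ * x₁ + d₂ * x₂ + d₃ * x₃ = k * N) (hpos : 0 < d₁ + d₂ + d₃) :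
    (a : ℤ) < d₁ ∨ (b : ℤ) < d₂ ∨ (c : ℤ) < d₃ := by
  by_contra! h
  obtain ⟨h₁, h₂, h₃⟩ := h
  obtain ⟨a', ha'⟩ := Int.eq_ofNat_of_zero_le (sub_nonneg.2 h₁)
  obtain ⟨b', hb'⟩ := Int.eq_ofNat_of_zero_le (sub_nonneg.2 h₂)
  obtain ⟨c', hc'⟩ := Int.eq_ofNat_of_zero_le (sub_nonneg.2 h₃)
  have hle : a + b + c ≤ a' + b' + c' := by
    refine hmin a' b' c' ?_
    rw [hg, ← ha', ← hb', ← hc', show ((a : ℤ) - d₁) * x₁ + (b - d₂) * x₂ + (c - d₃) * x₃ =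
      a * x₁ + b * x₂ + c * x₃ - k * N by rw [← hd]; ring]
    push_cast
    simp
  omega

/-- Coefficient triples avoiding the staircase of relations lie in the simplex of size
`10 * x + 2`. -/
lemma sum_le_of_staircase (x a b c : ℤ) (hx : 1 ≤ x) (ha : 0 ≤ a) (hb : 0 ≤ b) (hc : 0 ≤ c)
    (h : ∀ d₁ d₂ d₃ k : ℤ,
      d₁ * -(21*x^2 + 15*x + 2) + d₂ * (21*x^2 + 8*x) + d₃ * -(42*x^2 + 23*x + 3) =
        k * (84*x^3 + 74*x^2 + 18*x + 1) →
      0 < d₁ + d₂ + d₃ → a < d₁ ∨ b < d₂ ∨ c < d₃) :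
    a + b + c ≤ 10*x + 2 := by
  have := h (8*x+3) (-2*x) (-(5*x+2)) 0 (by ring) (by omega)
  have := h (7*x+2) x (-(x+1)) (-1) (by ring) (by omega)
  have := h (5*x+1) (-(x+1)) x (-2) (by ring) (by omega)
  have := h (3*x) (-(3*x+2)) (3*x+1) (-3) (by ring) (by omega)
  have := h (2*x+1) (2*x+1) (-(2*x+1)) 1 (by ring) (by omega)
  have := h (x+2) (7*x+4) (-(7*x+3)) 5 (by ring) (by omega)
  have := h x (5*x+1) (2*x) 0 (by ring) (by omega)
  have : x ≤ 2 ∨ a < x - 1 ∨ b < -(5*x+3) ∨ c < 5*x+2 :=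
    or_iff_not_imp_left.2 fun _ => h _ _ _ (-4) (by ring) (by omega)
  have := h (2*x-1) (-2) (7*x+2) (-4) (by ring) (by omega)
  have := h (-2*x) (8*x+3) (-(x+1)) 3 (by ring) (by omega)
  have := h (-(4*x+1)) (6*x+2) x 2 (by ring) (by omega)
  have := h (-(6*x+2)) (4*x+1) (3*x+1) 1 (by ring) (by omega)
  have := h (-(x+1)) (3*x) (4*x+1) (-1) (by ring) (by omega)
  have := h (-(3*x+2)) (x-1) (6*x+2) (-2) (by ring) (by omega)
  have : x ≤ 1 ∨ a < -(5*x+3) ∨ b < -(x+2) ∨ c < 8*x+3 :=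
    or_iff_not_imp_left.2 fun _ => h _ _ _ (-3) (by ring) (by omega)
  omega

/-- Proposition 7: for `x ≥ 1` and `N = 84x³ + 74x² + 18x + 1`,
the Cayley digraph `Cay(ℤ/Nℤ, {-(21x²+15x+2), 21x²+8x, -(42x²+23x+3)})` has diameter
at most `10x + 2`: every element is a nonnegative combination of the three generators
with coefficient sum at most `10x + 2`. -/
theorem diameter_cyclic_family (x : ℕ) (hx : 1 ≤ x) (N : ℕ)
    (hN : N = 84*x^3 + 74*x^2 + 18*x + 1) (g₁ g₂ g₃ : ZMod N)
    (h₁ : g₁ = -((21*x^2 + 15*x + 2 : ℕ) : ZMod N))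
    (h₂ : g₂ = ((21*x^2 + 8*x : ℕ) : ZMod N))
    (h₃ : g₃ = -((42*x^2 + 23*x + 3 : ℕ) : ZMod N)) :
    ∀ g : ZMod N, ∃ a₁ a₂ a₃ : ℕ,
      g = a₁ • g₁ + a₂ • g₂ + a₃ • g₃ ∧ a₁ + a₂ + a₃ ≤ 10*x + 2 := by
  intro g
  have hNZ : (N : ℤ) = 84*x^3 + 74*x^2 + 18*x + 1 := by exact_mod_cast hN
  have : NeZero N := ⟨by omega⟩
  let Rep : ℕ → ℕ → ℕ → Prop := fun a b c =>
    g = ((a * -(21*x^2 + 15*x + 2) + b * (21*x^2 + 8*x) + c * -(42*x^2 + 23*x + 3) : ℤ) : ZMod N)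
  have hex : ∃ s a b c, Rep a b c ∧ a + b + c = s := by
    obtain ⟨r, rfl⟩ := ZMod.natCast_zmod_surjective g
    refine ⟨_, r, (84*x^3 + 74*x^2 + 18*x) * r, (84*x^3 + 74*x^2 + 18*x) * r, ?_, rfl⟩
    have hcast : (84*x^3 + 74*x^2 + 18*x : ZMod N) = -1 := by
      have h : ((84*x^3 + 74*x^2 + 18*x + 1 : ℕ) : ZMod N) = 0 := by rw [← hN]; simp
      push_cast at h
      linear_combination h
    simp only [Rep]
    push_cast
    rw [hcast]
    ring
  classical
  obtain ⟨a, b, c, hrep, hs⟩ := Nat.find_spec hex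
  have hmin : ∀ a' b' c' : ℕ, Rep a' b' c' → a + b + c ≤ a' + b' + c' := fun a' b' c' h =>
    hs ▸ Nat.find_min' hex ⟨a', b', c', h, rfl⟩
  refine ⟨a, b, c, ?_, ?_⟩
  · rw [hrep, h₁, h₂, h₃]
    simp only [nsmul_eq_mul]
    push_cast
    ring
  · have := sum_le_of_staircase x a b c (by omega) (by omega) (by omega) (by omega)
      fun d₁ d₂ d₃ k hd hpos =>
        lt_of_minimal_of_relation hrep hmin d₁ d₂ d₃ k (by rw [hNZ]; exact hd) hpos
    omega
end

section
/- For every integer t ≥ 1, the group Γ_t = ℤ/tℤ ⊕ ℤ/tℤ ⊕ ℤ/84tℤ has order 84t³, and with generators γ₁ = (1, 10, −38), γ₂ = (0, 1, −3), γ₃ = (0, −2, 7), the Cayley digraph Cay(Γ_t, {γ₁, γ₂, γ₃}) has diameter exactly 10t − 3: every g ∈ Γ_t can be written g = a₁γ₁ + a₂γ₂ + a₃γ₃ with a₁, a₂, a₃ ∈ ℕ and a₁ + a₂ + a₃ ≤ 10t − 3, and there exists g ∈ Γ_t admitting no such representation with a₁ + a₂ + a₃ < 10t − 3. -/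
/-- `Cay(ℤ/84ℤ, {-38, -3, 7})` has diameter at most `7`. -/
lemma exists_rep_mod_eightyFour (c : ℤ) :
    ∃ b₁ b₂ b₃ : ℕ, b₁ + b₂ + b₃ ≤ 7 ∧ (84 : ℤ) ∣ -38 * b₁ - 3 * b₂ + 7 * b₃ - c := by
  have key : ∀ r : Fin 84, ∃ b₁ b₂ b₃ : Fin 8, b₁.val + b₂.val + b₃.val ≤ 7 ∧
      (46 * b₁.val + 81 * b₂.val + 7 * b₃.val) % 84 = r.val := by
    decide +kernel
  obtain ⟨b₁, b₂, b₃, hs, hb⟩ := key ⟨(c % 84).toNat, by omega⟩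
  refine ⟨b₁, b₂, b₃, hs, ?_⟩
  simp only at hb
  omega

/-- The element `49` of `ℤ/84ℤ` is at distance at least `7` from `0` in
`Cay(ℤ/84ℤ, {-38, -3, 7})`. -/
lemma seven_le_of_rep_mod_eightyFour (b₁ b₂ b₃ : ℕ)
    (h : (84 : ℤ) ∣ -38 * b₁ - 3 * b₂ + 7 * b₃ - 49) :
    7 ≤ b₁ + b₂ + b₃ := by
  have key : ∀ b₁ b₂ b₃ : Fin 7, b₁.val + b₂.val + b₃.val < 7 →
      (46 * b₁.val + 81 * b₂.val + 7 * b₃.val) % 84 ≠ 49 := by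
    decide +kernel
  by_contra! hlt
  have := key ⟨b₁, by omega⟩ ⟨b₂, by omega⟩ ⟨b₃, by omega⟩ hlt
  simp only at this
  omega

/-- A natural number congruent to `-1` modulo `t` has the form `t * b + (t - 1)`. -/
lemma exists_eq_mul_add_pred {t a : ℕ} (h : (t : ℤ) ∣ a + 1) :
    ∃ b : ℕ, a + 1 = t * b + t := by
  obtain ⟨k, hk⟩ : t ∣ a + 1 := by exact_mod_cast h
  obtain _ | k := k
  · simp at hk
  · exact ⟨k, by rw [hk]; ring⟩

/-- Equality of an integer triple and a natural combination of the three generators,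
in terms of divisibility. -/
lemma intCast_eq_combination_iff (t : ℕ) (n₁ n₂ n₃ : ℤ) (a₁ a₂ a₃ : ℕ) :
    (((n₁ : ZMod t), (n₂ : ZMod t), (n₃ : ZMod (84 * t))) : ZMod t × ZMod t × ZMod (84 * t)) =
        a₁ • ((1 : ZMod t), (10 : ZMod t), (-38 : ZMod (84 * t))) +
          a₂ • ((0 : ZMod t), (1 : ZMod t), (-3 : ZMod (84 * t))) +
          a₃ • ((0 : ZMod t), (-2 : ZMod t), (7 : ZMod (84 * t))) ↔
      (t : ℤ) ∣ a₁ - n₁ ∧ (t : ℤ) ∣ 10 * a₁ + a₂ - 2 * a₃ - n₂ ∧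
        84 * (t : ℤ) ∣ -38 * a₁ - 3 * a₂ + 7 * a₃ - n₃ := by
  have h84 : (84 * (t : ℤ)) = ((84 * t : ℕ) : ℤ) := by push_cast; rfl
  rw [h84, ← ZMod.intCast_eq_intCast_iff_dvd_sub, ← ZMod.intCast_eq_intCast_iff_dvd_sub,
    ← ZMod.intCast_eq_intCast_iff_dvd_sub]
  simp only [Prod.smul_mk, Prod.mk_add_mk, Prod.mk.injEq, nsmul_eq_mul]
  push_cast
  refine and_congr ?_ (and_congr ?_ ?_) <;> refine Eq.congr rfl ?_ <;> ring

/-- Proposition 9: for every `t ≥ 1`, the group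
`Γ_t = ℤ/tℤ ⊕ ℤ/tℤ ⊕ ℤ/84tℤ` has order `84t³` and the Cayley digraph
`Cay(Γ_t, {(1,10,-38), (0,1,-3), (0,-2,7)})` has diameter exactly `10t - 3`. -/
theorem dense_family_degree_three (t : ℕ) (ht : 1 ≤ t)
    (γ₁ γ₂ γ₃ : ZMod t × ZMod t × ZMod (84*t))
    (h₁ : γ₁ = ((1 : ZMod t), (10 : ZMod t), (-38 : ZMod (84*t))))
    (h₂ : γ₂ = ((0 : ZMod t), (1 : ZMod t), (-3 : ZMod (84*t))))
    (h₃ : γ₃ = ((0 : ZMod t), (-2 : ZMod t), (7 : ZMod (84*t)))) :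
    Nat.card (ZMod t × ZMod t × ZMod (84*t)) = 84 * t^3 ∧
    (∀ g : ZMod t × ZMod t × ZMod (84*t), ∃ a₁ a₂ a₃ : ℕ,
      g = a₁ • γ₁ + a₂ • γ₂ + a₃ • γ₃ ∧ a₁ + a₂ + a₃ ≤ 10*t - 3) ∧
    (∃ g : ZMod t × ZMod t × ZMod (84*t), ∀ a₁ a₂ a₃ : ℕ,
      g = a₁ • γ₁ + a₂ • γ₂ + a₃ • γ₃ → 10*t - 3 ≤ a₁ + a₂ + a₃) := by
  subst h₁ h₂ h₃
  have hpos : (0 : ℤ) < t := by exact_mod_cast ht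
  refine ⟨?_, ?_, ?_⟩
  · simp only [Nat.card_prod, Nat.card_zmod]
    ring
  · rintro ⟨g₁, g₂, g₃⟩
    obtain ⟨n₁, rfl⟩ := ZMod.intCast_surjective g₁
    obtain ⟨n₂, rfl⟩ := ZMod.intCast_surjective g₂
    obtain ⟨n₃, rfl⟩ := ZMod.intCast_surjective g₃
    have division : ∀ x : ℤ, ∃ (q : ℤ) (r : ℕ), x = t * q + r ∧ r + 1 ≤ t := fun x => by
      refine ⟨x / t, (x % t).toNat, ?_, ?_⟩
      · rw [Int.toNat_of_nonneg (Int.emod_nonneg _ hpos.ne'), Int.mul_ediv_add_emod]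
      · have := Int.emod_lt_of_pos x hpos
        omega
    obtain ⟨q₁, r₁, hx₁, hr₁⟩ := division n₁
    obtain ⟨q₂, r₂, hx₂, hr₂⟩ := division (6 * n₁ + 7 * n₂ + 2 * n₃)
    obtain ⟨q₃, r₃, hx₃, hr₃⟩ := division (8 * n₁ + 3 * n₂ + n₃)
    obtain ⟨b₁, b₂, b₃, hs, k, hk⟩ := exists_rep_mod_eightyFour (-38 * q₁ - 3 * q₂ + 7 * q₃)
    refine ⟨t * b₁ + r₁, t * b₂ + r₂, t * b₃ + r₃,
      (intCast_eq_combination_iff ..).2 ⟨⟨b₁ - q₁, ?_⟩,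
        ⟨10 * (b₁ - q₁) + (b₂ - q₂) - 2 * (b₃ - q₃), ?_⟩, ⟨k, ?_⟩⟩, ?_⟩
    · push_cast
      linear_combination -hx₁
    · push_cast
      linear_combination -10 * hx₁ - hx₂ + 2 * hx₃
    · push_cast
      linear_combination 38 * hx₁ + 3 * hx₂ - 7 * hx₃ + t * hk
    · have := Nat.mul_le_mul_left t hs
      have : t * (b₁ + b₂ + b₃) = t * b₁ + t * b₂ + t * b₃ := by ring
      omega
  · refine ⟨(((t - 1 : ℤ) : ZMod t),
      ((10 * (t - 1) + (t - 1) - 2 * (8 * t - 1) : ℤ) : ZMod t),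
      ((-38 * (t - 1) - 3 * (t - 1) + 7 * (8 * t - 1) : ℤ) :
        ZMod (84 * t))), fun a₁ a₂ a₃ h => ?_⟩
    obtain ⟨⟨k₁, hk₁⟩, ⟨k₂, hk₂⟩, ⟨k₃, hk₃⟩⟩ := (intCast_eq_combination_iff ..).1 h
    obtain ⟨b₁, hb₁⟩ := exists_eq_mul_add_pred (t := t) (a := a₁) ⟨k₁ + 1, by
      linear_combination hk₁⟩
    obtain ⟨b₂, hb₂⟩ := exists_eq_mul_add_pred (t := t) (a := a₂)
      ⟨6 * k₁ + 7 * k₂ + 168 * k₃ + 1, by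
        linear_combination 6 * hk₁ + 7 * hk₂ + 2 * hk₃⟩
    obtain ⟨b₃, hb₃⟩ := exists_eq_mul_add_pred (t := t) (a := a₃)
      ⟨8 * k₁ + 3 * k₂ + 84 * k₃ + 8, by
        linear_combination 8 * hk₁ + 3 * hk₂ + hk₃⟩
    have hseven := seven_le_of_rep_mod_eightyFour b₁ b₂ b₃ ⟨k₃, mul_left_cancel₀ hpos.ne' (by
      zify at hb₁ hb₂ hb₃
      linear_combination hk₃ + 38 * hb₁ + 3 * hb₂ - 7 * hb₃)⟩
    have := Nat.mul_le_mul_left t hseven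
    have : t * (b₁ + b₂ + b₃) = t * b₁ + t * b₂ + t * b₃ := by ring
    omega
end

section
/- Let d ≥ 2 and t ≥ 1 be integers, and let Γ_{d,t} = ℤ/tℤ ⊕ (ℤ/t(d+1)ℤ)^{d−1}. Let the generating set A_d consist of γ₁ = (1, 1, …, 1) (the all-ones vector) and, for each j ∈ {1, …, d−1}, the vector γ_{j+1} whose coordinates are all 1 except for a 2 in the j-th of the last d−1 coordinates. Then the Cayley digraph Cay(Γ_{d,t}, A_d) has diameter exactly t·((d+1)d/2) − d. -/
open Finset

/-- A shift permutes the residues modulo `n`. -/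
lemma sum_range_add_mod (n q : ℕ) :
    ∑ i ∈ range n, (q + i) % n = ∑ i ∈ range n, i := by
  induction q with
  | zero => exact sum_congr rfl fun i hi => by simpa using Nat.mod_eq_of_lt (mem_range.1 hi)
  | succ q ih =>
    rw [← ih]
    have h₁ := sum_range_succ (fun i => (q + i) % n) n
    have h₂ := sum_range_succ' (fun i => (q + i) % n) n
    have h₃ : ∑ i ∈ range n, (q + 1 + i) % n = ∑ i ∈ range n, (q + (i + 1)) % n :=
      sum_congr rfl fun i _ => by congr 1; ring
    simp only [Nat.add_mod_right, Nat.add_zero] at h₁ h₂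
    omega

/-- Some shift of `e` residues modulo `e + 2` has a small sum. The sums, each increased by its
shift, are pairwise incongruent modulo `e + 2`, so their minimum lies below their average. -/
lemma exists_shift_sum_mod_le (e : ℕ) (q : Fin e → ℕ) :
    ∃ i, ∑ j, (q j + i) % (e + 2) + i ≤ ∑ i ∈ range (e + 1), i := by
  by_contra! hlt
  set K := ∑ i ∈ range (e + 1), i
  set F : ℕ → ℕ := fun i => ∑ j, (q j + i) % (e + 2) + i with hF
  have hlt' : ∀ i, K + 1 ≤ F i := hlt
  have hsum : ∑ i ∈ range (e + 2), F i = (e + 1) * ∑ i ∈ range (e + 2), i := by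
    simp only [hF, sum_add_distrib]
    rw [sum_comm]
    simp only [sum_range_add_mod, sum_const, card_univ, Fintype.card_fin, smul_eq_mul]
    ring
  set c := ∑ j, q j + (K + 1) * (e + 1) + 1 with hc
  have hF_mod : ∀ i ∈ range (e + 2), (c + (e + 2 - 1 - i)) % (e + 2) ≤ F i - (K + 1) := by
    intro i hi
    have hi' := mem_range.1 hi
    obtain ⟨x, hx⟩ := Nat.exists_eq_add_of_le (hlt' i)
    have hcast : ((F i : ℕ) : ZMod (e + 2)) = ((∑ j, q j + (e + 1) * i : ℕ) : ZMod (e + 2)) := by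
      simp only [hF]
      push_cast [ZMod.natCast_mod]
      simp only [sum_add_distrib, sum_const, card_univ, Fintype.card_fin, nsmul_eq_mul]
      ring
    have hcong : ((c + (e + 2 - 1 - i) : ℕ) : ZMod (e + 2)) = (x : ℕ) := by
      have hn : ((e : ZMod (e + 2)) + 2) = 0 := by
        have := ZMod.natCast_self (e + 2)
        push_cast at this
        exact this
      rw [hx] at hcast
      have hs : ((e + 1 - i : ℕ) : ZMod (e + 2)) = e + 1 - i := by
        rw [Nat.cast_sub (by omega)]
        push_cast
        rfl
      push_cast [hc] at hcast ⊢
      rw [hs]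
      linear_combination -hcast + (1 + (K + 1 : ZMod (e + 2)) - i) * hn
    have := (ZMod.natCast_eq_natCast_iff _ _ _).1 hcong
    rw [this, hx, Nat.add_sub_cancel_left]
    exact Nat.mod_le _ _
  have hle := sum_le_sum hF_mod
  rw [sum_range_reflect (fun i => (c + i) % (e + 2)) (e + 2), sum_range_add_mod] at hle
  have hsplit : ∑ i ∈ range (e + 2), F i
      = ∑ i ∈ range (e + 2), (F i - (K + 1)) + (e + 2) * (K + 1) := by
    rw [sum_congr rfl fun i _ => (Nat.sub_add_cancel (hlt' i)).symm, sum_add_distrib]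
    simp
  have hK2 : K * 2 = (e + 1) * e := by simpa using sum_range_id_mul_two (e + 1)
  have hsucc : ∑ i ∈ range (e + 2), i = K + (e + 1) := sum_range_succ _ _
  rw [hsucc] at hsum hle
  nlinarith

/-- For the residues `1, …, e` modulo `e + 2`, every nonzero shift has a large sum. -/
lemma lt_sum_succ_add_mod (e i : ℕ) (hi : 1 ≤ i) :
    ∑ i ∈ range (e + 1), i < ∑ j : Fin e, ((j : ℕ) + 1 + i) % (e + 2) + i := by
  have h := sum_range_add_mod (e + 2) i
  rw [sum_range_succ, sum_range_succ', sum_range_succ (fun i => i)] at h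
  rw [Fin.sum_univ_eq_sum_range (fun j => (j + 1 + i) % (e + 2))]
  have h₁ : ∑ j ∈ range e, (j + 1 + i) % (e + 2) = ∑ j ∈ range e, (i + (j + 1)) % (e + 2) :=
    sum_congr rfl fun j _ => by rw [add_comm]
  rw [h₁]
  have h₂ : i % (e + 2) + (i + (e + 1)) % (e + 2) ≤ i + e := by
    have hlt : i % (e + 2) < e + 2 := Nat.mod_lt _ (by omega)
    have hle := Nat.mod_le i (e + 2)
    rw [Nat.add_mod i (e + 1), Nat.mod_eq_of_lt (show e + 1 < e + 2 by omega)]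
    generalize i % (e + 2) = k at *
    rcases Nat.eq_zero_or_pos k with h0 | h0
    · rw [h0, Nat.zero_add, Nat.mod_eq_of_lt (by omega)]
      omega
    · rw [Nat.mod_eq_sub_mod (by omega), Nat.mod_eq_of_lt (by omega)]
      omega
  simp only [Nat.add_zero] at h
  omega

lemma add_mul_mod_mul (u t i n : ℕ) (ht : 1 ≤ t) :
    (u + t * i) % (t * n) = u % t + t * ((u / t + i) % n) := by
  rw [Nat.mod_mul, Nat.add_mul_mod_self_left, Nat.add_mul_div_left _ _ ht]

lemma eq_sum_smul_iff {e t m : ℕ} {γ : Fin (e + 1) → ZMod t × (Fin e → ZMod m)}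
    (hγ : ∀ j, γ j = (1, fun i : Fin e => if (j : ℕ) = (i : ℕ) + 1 then 2 else 1))
    (g : ZMod t × (Fin e → ZMod m)) (a : Fin (e + 1) → ℕ) :
    g = ∑ i, a i • γ i ↔
      g.1 = ((∑ i, a i : ℕ) : ZMod t) ∧ ∀ j, g.2 j = ((∑ i, a i + a j.succ : ℕ) : ZMod m) := by
  have h1 : (∑ i, a i • γ i).1 = ((∑ i, a i : ℕ) : ZMod t) := by
    simp [Prod.fst_sum, hγ]
  have h2 : ∀ j, (∑ i, a i • γ i).2 j = ((∑ i, a i + a j.succ : ℕ) : ZMod m) := by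
    intro j
    have hterm : ∀ i : Fin (e + 1), (a i • γ i).2 j
        = (a i : ZMod m) + if i = j.succ then (a i : ZMod m) else 0 := by
      intro i
      have hiff : (i : ℕ) = (j : ℕ) + 1 ↔ i = j.succ := by rw [Fin.ext_iff, Fin.val_succ]
      rw [hγ]
      rw [Prod.smul_snd, Pi.smul_apply, nsmul_eq_mul]
      simp only [hiff]
      split_ifs <;> ring
    rw [Prod.snd_sum, Finset.sum_apply, sum_congr rfl fun i _ => hterm i, sum_add_distrib]
    simp
  rw [Prod.ext_iff, h1, funext_iff]
  simp only [h2]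

section Diameter

variable {e t : ℕ} {γ : Fin (e + 1) → ZMod t × (Fin e → ZMod (t * (e + 2)))}

lemma exists_sum_smul_eq (ht : 1 ≤ t)
    (hγ : ∀ j, γ j = (1, fun i : Fin e => if (j : ℕ) = (i : ℕ) + 1 then 2 else 1))
    {M : ℕ} (hM : M + (e + 1) = t * ∑ i ∈ range (e + 2), i)
    (g : ZMod t × (Fin e → ZMod (t * (e + 2)))) :
    ∃ a : Fin (e + 1) → ℕ, g = ∑ i, a i • γ i ∧ ∑ i, a i ≤ M := by
  have : NeZero t := ⟨by omega⟩
  have : NeZero (t * (e + 2)) := ⟨by positivity⟩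
  rw [sum_range_succ] at hM
  set r := ((M : ZMod t) - g.1).val with hr
  have hrt : r < t := ZMod.val_lt _
  have hrM : r ≤ M := by
    nlinarith [Nat.mul_le_mul_right e ht, Nat.zero_le (t * ∑ i ∈ range (e + 1), i)]
  obtain ⟨s₀, hs₀⟩ := Nat.exists_eq_add_of_le hrM
  set u : Fin e → ℕ := fun j => (g.2 j - (s₀ : ZMod (t * (e + 2)))).val with hu
  obtain ⟨i, hi⟩ := exists_shift_sum_mod_le e (fun j => u j / t)
  set b : Fin e → ℕ := fun j => (u j + t * i) % (t * (e + 2)) with hb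
  have hbsum : ∑ j, b j + t * i ≤ s₀ := by
    have h₁ : ∑ j, b j = ∑ j, u j % t + t * ∑ j, (u j / t + i) % (e + 2) := by
      simp only [hb, add_mul_mod_mul _ _ _ _ ht, sum_add_distrib, mul_sum]
    have h₂ : ∑ j, u j % t ≤ e * (t - 1) := by
      have := sum_le_card_nsmul univ (fun j => u j % t) (t - 1)
        fun j _ => Nat.le_sub_one_of_lt (Nat.mod_lt _ ht)
      simpa using this
    have h₃ := Nat.mul_le_mul_left t hi
    obtain ⟨t', rfl⟩ := Nat.exists_eq_add_of_le ht
    simp only [Nat.add_sub_cancel_left] at h₂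
    nlinarith
  obtain ⟨a₀, ha₀⟩ := Nat.exists_eq_add_of_le hbsum
  have hs : ∑ k, (Fin.cons a₀ b : Fin (e + 1) → ℕ) k = a₀ + ∑ j, b j := by
    simp [Fin.sum_univ_succ]
  refine ⟨Fin.cons a₀ b, (eq_sum_smul_iff hγ _ _).2 ⟨?_, fun j => ?_⟩, ?_⟩
  · have h₁ : (r : ZMod t) = M - g.1 := by rw [hr, ZMod.natCast_zmod_val]
    have h₂ := congrArg (Nat.cast : ℕ → ZMod t) (hs₀.trans (congrArg (r + ·) ha₀))
    rw [hs]
    push_cast at h₂ ⊢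
    rw [ZMod.natCast_self] at h₂
    linear_combination h₁ + h₂
  · have h₁ : (u j : ZMod (t * (e + 2))) = g.2 j - s₀ := by simp only [hu, ZMod.natCast_zmod_val]
    have h₂ := congrArg (Nat.cast : ℕ → ZMod (t * (e + 2))) ha₀
    have h₃ : (b j : ZMod (t * (e + 2))) = u j + t * i := by
      simp only [hb, ZMod.natCast_mod]
      push_cast
      rfl
    rw [hs, Fin.cons_succ]
    push_cast at h₂ ⊢
    linear_combination -h₁ + h₂ - h₃
  · rw [hs]
    omega

lemma exists_forall_le_sum (ht : 1 ≤ t)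
    (hγ : ∀ j, γ j = (1, fun i : Fin e => if (j : ℕ) = (i : ℕ) + 1 then 2 else 1))
    {M : ℕ} (hM : M + (e + 1) = t * ∑ i ∈ range (e + 2), i) :
    ∃ g : ZMod t × (Fin e → ZMod (t * (e + 2))),
      ∀ a : Fin (e + 1) → ℕ, g = ∑ i, a i • γ i → M ≤ ∑ i, a i := by
  rw [sum_range_succ] at hM
  refine ⟨(M, fun j => ((M + ((t - 1) + t * ((j : ℕ) + 1)) : ℕ) : ZMod (t * (e + 2)))),
    fun a ha => ?_⟩
  obtain ⟨h1, h2⟩ := (eq_sum_smul_iff hγ _ _).1 ha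
  by_contra! hlt
  set s := ∑ i, a i with hs
  obtain ⟨i, hi⟩ : t ∣ M - s :=
    (Nat.modEq_iff_dvd' hlt.le).1 ((ZMod.natCast_eq_natCast_iff _ _ _).1 h1).symm
  have hMs : M = s + t * i := by omega
  have hi1 : 1 ≤ i := by
    rcases Nat.eq_zero_or_pos i with rfl | h
    · omega
    · exact h
  have hle : ∀ j : Fin e, (t - 1) + t * (((j : ℕ) + 1 + i) % (e + 2)) ≤ a j.succ := by
    intro j
    have hmod : (a j.succ) ≡ (t - 1) + t * ((j : ℕ) + 1 + i) [MOD t * (e + 2)] := by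
      have := (ZMod.natCast_eq_natCast_iff _ _ _).1 (h2 j)
      refine (Nat.ModEq.add_left_cancel' s ?_).symm
      convert this using 1
      rw [hMs]
      ring
    have heq := add_mul_mod_mul (t - 1) t ((j : ℕ) + 1 + i) (e + 2) ht
    rw [Nat.mod_eq_of_lt (by omega : t - 1 < t), Nat.div_eq_of_lt (by omega : t - 1 < t),
      Nat.zero_add] at heq
    rw [← heq, ← hmod]
    exact Nat.mod_le _ _
  have hsum := sum_le_sum fun j (_ : j ∈ univ) => hle j
  rw [sum_add_distrib, ← mul_sum] at hsum
  simp only [sum_const, card_univ, Fintype.card_fin, smul_eq_mul] at hsum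
  rw [Fin.sum_univ_succ] at hs
  have hF := Nat.mul_le_mul_left t (Nat.succ_le_of_lt (lt_sum_succ_add_mod e i hi1))
  obtain ⟨t', rfl⟩ := Nat.exists_eq_add_of_le ht
  simp only [Nat.add_sub_cancel_left] at hsum
  nlinarith

end Diameter

/-- Proposition 10: for `d ≥ 2`, `t ≥ 1`, the Cayley digraph
`Cay(ℤ/tℤ ⊕ (ℤ/t(d+1)ℤ)^{d-1}, A_d)` has diameter exactly `t·((d+1)d/2) - d`,
where `A_d` consists of the all-ones vector and, for each `j ∈ {1,…,d-1}`, the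
vector whose coordinates are all `1` except a `2` in the `j`-th of the last `d-1`
coordinates. -/
theorem dense_family_any_degree (d t : ℕ) (hd : 2 ≤ d) (ht : 1 ≤ t)
    (γ : Fin d → ZMod t × (Fin (d-1) → ZMod (t*(d+1))))
    (hγ : ∀ j : Fin d, γ j = (1, fun i : Fin (d-1) => if (j : ℕ) = (i : ℕ) + 1 then (2 : ZMod (t*(d+1))) else 1)) :
    (∀ g : ZMod t × (Fin (d-1) → ZMod (t*(d+1))), ∃ a : Fin d → ℕ,
      g = ∑ i, a i • γ i ∧ ∑ i, a i ≤ t * ((d+1)*d/2) - d) ∧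
    (∃ g : ZMod t × (Fin (d-1) → ZMod (t*(d+1))), ∀ a : Fin d → ℕ,
      g = ∑ i, a i • γ i → t * ((d+1)*d/2) - d ≤ ∑ i, a i) := by
  obtain ⟨e, rfl⟩ : ∃ e, d = e + 1 := ⟨d - 1, by omega⟩
  have hK : (e + 1 + 1) * (e + 1) / 2 = ∑ i ∈ range (e + 2), i :=
    (sum_range_id (e + 2)).symm
  have hM : t * ((e + 1 + 1) * (e + 1) / 2) - (e + 1) + (e + 1)
      = t * ∑ i ∈ range (e + 2), i := by
    rw [hK, sum_range_succ]
    exact Nat.sub_add_cancel (by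
      nlinarith [Nat.mul_le_mul_right (e + 1) ht, Nat.zero_le (t * ∑ i ∈ range (e + 1), i)])
  exact ⟨exists_sum_smul_eq ht hγ hM, exists_forall_le_sum ht hγ hM⟩
end

section
/- Let d ≥ 2 be an integer, let F_d have vertex group (ℤ/(d+1)ℤ)^{d−1}, and let the generating set B_d ⊂ ℤ^{d−1} consist of the all-ones vector (1, 1, …, 1) together with, for each i ∈ {1, …, d−1}, the vector with a 2 in coordinate i and 1 in every other coordinate (so B_d has d elements). Then the Cayley digraph Cay((ℤ/(d+1)ℤ)^{d−1}, B_d) has diameter exactly d(d−1)/2. -/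
/-- The sum of a finite set of `n` naturals is at least `0 + 1 + ⋯ + (n - 1)`. -/
theorem card_mul_pred_le_two_mul_sum (s : Finset ℕ) :
    s.card * (s.card - 1) ≤ 2 * ∑ x ∈ s, x := by
  have h := Finset.sum_range_id_mul_two s.card
  have hle := Finset.sum_range_le_sum (s := s.map Nat.castEmbedding) (c := (0 : ℤ)) (by simp)
  simp only [Finset.card_map, Finset.sum_map, Nat.castEmbedding_apply, zero_add] at hle
  have hle : ∑ i ∈ Finset.range s.card, i ≤ ∑ x ∈ s, x := by
    zify
    exact hle
  omega

theorem card_mul_pred_le_two_mul_sum_of_injective {ι : Type*} [Fintype ι] (f : ι → ℕ)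
    (hf : Function.Injective f) :
    Fintype.card ι * (Fintype.card ι - 1) ≤ 2 * ∑ i, f i := by
  have h := card_mul_pred_le_two_mul_sum (Finset.univ.map ⟨f, hf⟩)
  simpa using h

theorem two_mul_sum_val_sub (n : ℕ) [NeZero n] (x : ZMod n) :
    2 * ∑ s, (x - s).val = n * (n - 1) := by
  have hshift : ∑ s, (x - s).val = ∑ s : ZMod n, s.val :=
    Equiv.sum_comp (Equiv.subLeft x) ZMod.val
  rw [hshift]
  obtain ⟨k, rfl⟩ := Nat.exists_eq_succ_of_ne_zero (NeZero.ne n)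
  have h := Finset.sum_range_id_mul_two (k + 1)
  rw [← Fin.sum_univ_eq_sum_range (fun i => i)] at h
  rw [mul_comm]
  exact h

/-- For `d` residues modulo `d + 1` summing to zero, some common shift makes the sum of the
least nonnegative representatives at most `d (d - 1) / 2`. -/
theorem exists_two_mul_sum_val_sub_le (d : ℕ) (x : Fin d → ZMod (d + 1)) (hx : ∑ j, x j = 0) :
    ∃ s, 2 * ∑ j, (x j - s).val ≤ d * (d - 1) ∧ ((∑ j, (x j - s).val : ℕ) : ZMod (d + 1)) = s := by
  have hd : (d : ZMod (d + 1)) = -1 := by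
    rw [eq_neg_iff_add_eq_zero]
    exact_mod_cast ZMod.natCast_self (d + 1)
  have hcast (s : ZMod (d + 1)) : ((∑ j, (x j - s).val : ℕ) : ZMod (d + 1)) = s := by
    simp [Finset.sum_sub_distrib, hx, hd]
  by_contra! hlt
  replace hlt (s : ZMod (d + 1)) : d * (d - 1) / 2 + 1 ≤ ∑ j, (x j - s).val := by
    by_contra hs
    exact hlt s (by omega) (hcast s)
  choose f hf using fun s => Nat.exists_eq_add_of_le (hlt s)
  have hinj : Function.Injective f := fun s t hst => by
    rw [← hcast s, ← hcast t, hf, hf, hst]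
  have hlow := card_mul_pred_le_two_mul_sum_of_injective f hinj
  have htotal : 2 * ∑ s, ∑ j, (x j - s).val = d * ((d + 1) * d) := by
    rw [Finset.sum_comm, Finset.mul_sum]
    simp [two_mul_sum_val_sub]
  simp only [hf, Finset.sum_add_distrib, Finset.sum_const, Finset.card_univ, ZMod.card,
    smul_eq_mul, Nat.add_sub_cancel] at htotal hlow
  have heven := Nat.div_mul_cancel (Nat.even_mul_pred_self d).two_dvd
  rcases d with _ | d
  · simp at htotal
  · simp only [Nat.add_sub_cancel] at *
    nlinarith

/-- the digraphs `F_d` of [AgFiPe16a, Theorem 3.2]: for `d ≥ 2`,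
the Cayley digraph `Cay((ℤ/(d+1)ℤ)^{d-1}, B_d)` has diameter exactly `d(d-1)/2`,
where `B_d` consists of the all-ones vector and, for each `i ∈ {1,…,d-1}`, the
vector with a `2` in coordinate `i` and `1` elsewhere. -/
theorem diameter_Fd (d : ℕ) (hd : 2 ≤ d)
    (γ : Fin d → (Fin (d-1) → ZMod (d+1)))
    (hγ : ∀ j : Fin d, γ j = fun i : Fin (d-1) => if (j : ℕ) = (i : ℕ) + 1 then (2 : ZMod (d+1)) else 1) :
    (∀ g : Fin (d-1) → ZMod (d+1), ∃ a : Fin d → ℕ,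
      g = ∑ i, a i • γ i ∧ ∑ i, a i ≤ d*(d-1)/2) ∧
    (∃ g : Fin (d-1) → ZMod (d+1), ∀ a : Fin d → ℕ,
      g = ∑ i, a i • γ i → d*(d-1)/2 ≤ ∑ i, a i) := by
  obtain ⟨m, rfl⟩ : ∃ m, d = m + 1 := ⟨d - 1, by omega⟩
  change Fin (m + 1) → Fin m → ZMod (m + 1 + 1) at γ
  change (∀ g : Fin m → ZMod (m + 1 + 1), ∃ a : Fin (m + 1) → ℕ,
      g = ∑ i, a i • γ i ∧ ∑ i, a i ≤ (m + 1) * m / 2) ∧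
    (∃ g : Fin m → ZMod (m + 1 + 1), ∀ a : Fin (m + 1) → ℕ,
      g = ∑ i, a i • γ i → (m + 1) * m / 2 ≤ ∑ i, a i)
  have hm : (m : ZMod (m + 1 + 1)) = -2 := by
    rw [eq_neg_iff_add_eq_zero]
    exact_mod_cast ZMod.natCast_self (m + 1 + 1)
  have hcoord (a : Fin (m + 1) → ℕ) (i : Fin m) :
      (∑ j, a j • γ j) i = ((∑ j, a j : ℕ) : ZMod (m + 1 + 1)) + a i.succ := by
    have hterm (j : Fin (m + 1)) : (a j • γ j) i =
        (a j : ZMod (m + 1 + 1)) + if j = i.succ then (a j : ZMod (m + 1 + 1)) else 0 := by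
      have hiff : (j : ℕ) = (i : ℕ) + 1 ↔ j = i.succ := by simp [Fin.ext_iff]
      simp only [hγ, Pi.smul_apply, nsmul_eq_mul, hiff]
      split_ifs <;> ring
    rw [Finset.sum_apply, Finset.sum_congr rfl fun j _ => hterm j, Finset.sum_add_distrib]
    simp
  constructor
  · intro g
    obtain ⟨s, hle, hs⟩ := exists_two_mul_sum_val_sub_le (m + 1) (Fin.cons (-∑ i, g i) g)
      (by simp [Fin.sum_univ_succ])
    refine ⟨fun j => ((Fin.cons (-∑ i, g i) g : Fin (m + 1) → ZMod (m + 1 + 1)) j - s).val,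
      ?_, by rw [Nat.add_sub_cancel] at hle; beta_reduce; omega⟩
    funext i
    refine Eq.trans ?_ (hcoord _ i).symm
    rw [hs]
    simp
  · let c : ZMod (m + 1 + 1) := ((∑ i : Fin m, ((i : ℕ) + 1) : ℕ) : ZMod (m + 1 + 1))
    refine ⟨fun i => ((i.succ : ℕ) : ZMod (m + 1 + 1)) + c, fun a ha => ?_⟩
    have hsucc (i : Fin m) : ((i.succ : ℕ) : ZMod (m + 1 + 1)) + c =
        ((∑ j, a j : ℕ) : ZMod (m + 1 + 1)) + a i.succ := by
      rw [← hcoord]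
      exact congrFun ha i
    have hall (j : Fin (m + 1)) :
        (a j : ZMod (m + 1 + 1)) = (j : ℕ) + (c - ((∑ j, a j : ℕ) : ZMod (m + 1 + 1))) := by
      refine Fin.cases ?_ (fun i => by linear_combination -hsucc i) j
      have hsum := Finset.sum_congr (rfl : (Finset.univ : Finset (Fin m)) = _) fun i _ => hsucc i
      have hc : ∑ i : Fin m, ((i.succ : ℕ) : ZMod (m + 1 + 1)) = c := by simp [c]
      have hS : ((∑ j, a j : ℕ) : ZMod (m + 1 + 1)) =
          a 0 + ∑ i : Fin m, (a i.succ : ZMod (m + 1 + 1)) := by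
        simp [Fin.sum_univ_succ]
      rw [Finset.sum_add_distrib, Finset.sum_add_distrib, hc] at hsum
      simp only [Finset.sum_const, Finset.card_univ, Fintype.card_fin, nsmul_eq_mul, hm] at hsum
      simp only [Fin.val_zero, Nat.cast_zero]
      linear_combination hsum - hS
    have hinj : Function.Injective a := fun j k hjk => by
      have h : ((j : ℕ) : ZMod (m + 1 + 1)) = ((k : ℕ) : ZMod (m + 1 + 1)) := by
        have hj := hall j
        rw [hjk, hall k] at hj
        exact (add_right_cancel hj).symm
      rw [ZMod.natCast_eq_natCast_iff, Nat.ModEq, Nat.mod_eq_of_lt (by omega),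
        Nat.mod_eq_of_lt (by omega)] at h
      exact Fin.ext h
    have hlow := card_mul_pred_le_two_mul_sum_of_injective a hinj
    simp only [Fintype.card_fin, Nat.add_sub_cancel] at hlow
    omega
end

section
/- Let Γ be a finite abelian group of order N and let γ₁, γ₂ ∈ Γ be such that the Cayley digraph Cay(Γ, {γ₁, γ₂}) has diameter k (in particular every element of Γ is a nonnegative combination of γ₁ and γ₂). Then 3N ≤ (k + 2)²; equivalently, the density N/(k+2)² of any Abelian Cayley digraph of degree 2 is at most 1/3. -/
/-- `(x, y)` is the least pair, first by `x + y` and then by `x`, among the pairs representing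
the group element `x • γ₁ + y • γ₂`. -/
def IsMinRep {Γ : Type*} [AddCommGroup Γ] (γ₁ γ₂ : Γ) (x y : ℕ) : Prop :=
  ∀ x' y' : ℕ, x' • γ₁ + y' • γ₂ = x • γ₁ + y • γ₂ →
    x + y < x' + y' ∨ (x + y = x' + y' ∧ x ≤ x')

section MinRep

variable {Γ : Type*} [AddCommGroup Γ] {γ₁ γ₂ : Γ}

theorem IsMinRep.mono {x y a b : ℕ} (h : IsMinRep γ₁ γ₂ x y) (ha : a ≤ x) (hb : b ≤ y) :
    IsMinRep γ₁ γ₂ a b := by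
  intro x' y' e
  obtain ⟨c, rfl⟩ := Nat.exists_eq_add_of_le ha
  obtain ⟨d, rfl⟩ := Nat.exists_eq_add_of_le hb
  have key : (x' + c) • γ₁ + (y' + d) • γ₂ = (a + c) • γ₁ + (b + d) • γ₂ := by
    simp only [add_nsmul]
    rw [add_add_add_comm, e, add_add_add_comm]
  have := h _ _ key
  omega

theorem IsMinRep.unique {x y a b : ℕ} (h : IsMinRep γ₁ γ₂ x y) (h' : IsMinRep γ₁ γ₂ a b)
    (e : x • γ₁ + y • γ₂ = a • γ₁ + b • γ₂) : x = a ∧ y = b := by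
  have h₁ := h _ _ e.symm
  have h₂ := h' _ _ e
  omega

theorem exists_isMinRep (x y : ℕ) :
    ∃ a b, IsMinRep γ₁ γ₂ a b ∧ a • γ₁ + b • γ₂ = x • γ₁ + y • γ₂ := by
  by_cases hmin : IsMinRep γ₁ γ₂ x y
  · exact ⟨x, y, hmin, rfl⟩
  · have hlt := hmin
    unfold IsMinRep at hlt
    push Not at hlt
    obtain ⟨x', y', e, h₁, h₂⟩ := hlt
    have hdec : x' + y' < x + y ∨ (x' + y' = x + y ∧ x' < x) := by
      by_cases hs : x + y = x' + y'
      · exact Or.inr ⟨hs.symm, h₂ hs⟩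
      · omega
    obtain ⟨a, b, hab, e'⟩ := exists_isMinRep x' y'
    exact ⟨a, b, hab, e'.trans e⟩
termination_by (x + y, x)
decreasing_by
  rcases hdec with hs | ⟨hs, hx⟩
  · exact Prod.Lex.left _ _ hs
  · rw [hs]
    exact Prod.Lex.right _ hx

/-- A corner of the staircase of minimal representatives in the interior of the quadrant
represents `0`. -/
theorem corner_eq_zero {p q : ℕ} (hpq : ¬ IsMinRep γ₁ γ₂ (p + 1) (q + 1))
    (hp : IsMinRep γ₁ γ₂ p (q + 1)) (hq : IsMinRep γ₁ γ₂ (p + 1) q) :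
    (p + 1) • γ₁ + (q + 1) • γ₂ = 0 := by
  obtain ⟨a, b, hab, e⟩ := exists_isMinRep (γ₁ := γ₁) (γ₂ := γ₂) (p + 1) (q + 1)
  rw [← e]
  rcases a with _ | a
  · rcases b with _ | b
    · simp
    · have e' : 0 • γ₁ + b • γ₂ = (p + 1) • γ₁ + q • γ₂ := by
        rw [succ_nsmul γ₂ b, succ_nsmul γ₂ q, ← add_assoc, ← add_assoc] at e
        exact add_right_cancel e
      obtain ⟨h₁, -⟩ := (hab.mono le_rfl b.le_succ).unique hq e'
      omega
  · have e' : a • γ₁ + b • γ₂ = p • γ₁ + (q + 1) • γ₂ := by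
      rw [succ_nsmul γ₁ a, succ_nsmul γ₁ p, add_right_comm, add_right_comm (p • γ₁)] at e
      exact add_right_cancel e
    obtain ⟨rfl, rfl⟩ := (hab.mono a.le_succ le_rfl).unique hp e'
    exact absurd hab hpq

/-- No interior corner of the staircase of minimal representatives lies strictly to the right of
another one. -/
theorem corner_fst_le {p q r s : ℕ} (hpq : ¬ IsMinRep γ₁ γ₂ (p + 1) (q + 1))
    (hp : IsMinRep γ₁ γ₂ p (q + 1)) (hq : IsMinRep γ₁ γ₂ (p + 1) q)
    (hrs : ¬ IsMinRep γ₁ γ₂ (r + 1) (s + 1))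
    (hr : IsMinRep γ₁ γ₂ r (s + 1)) (hs : IsMinRep γ₁ γ₂ (r + 1) s) : r ≤ p := by
  by_contra! hlt
  have hsq : s < q := by
    by_contra! hle
    exact hpq (hr.mono hlt (by omega))
  obtain ⟨c, rfl⟩ := Nat.exists_eq_add_of_lt hlt
  obtain ⟨d, rfl⟩ := Nat.exists_eq_add_of_lt hsq
  have e := (corner_eq_zero hpq hp hq).trans (corner_eq_zero hrs hr hs).symm
  have e' : 0 • γ₁ + (d + 1) • γ₂ = (c + 1) • γ₁ + 0 • γ₂ := by
    have e₁ : (p + 1) • γ₁ + (s + 1) • γ₂ + (0 • γ₁ + (d + 1) • γ₂) =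
        (p + 1) • γ₁ + (s + 1) • γ₂ + ((c + 1) • γ₁ + 0 • γ₂) := by
      convert e using 1 <;> simp only [add_nsmul, zero_nsmul] <;> abel
    exact add_left_cancel e₁
  have := (hq.mono (a := 0) (b := d + 1) (by omega) (by omega)).unique
    (hr.mono (a := c + 1) (b := 0) (by omega) (by omega)) e'
  omega

end MinRep

/-- Below every point outside `D` there is a minimal point outside `D`. -/
theorem exists_corner_le (D : ℕ → ℕ → Prop) (x y : ℕ) (hxy : ¬ D x y) :
    ∃ p q, p ≤ x ∧ q ≤ y ∧ ¬ D p q ∧ (∀ a < p, D a q) ∧ ∀ b < q, D p b := by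
  by_cases hx : ∀ a < x, D a y
  · by_cases hy : ∀ b < y, D x b
    · exact ⟨x, y, le_rfl, le_rfl, hxy, hx, hy⟩
    · push Not at hy
      obtain ⟨b, hb, hD⟩ := hy
      obtain ⟨p, q, hp, hq, h⟩ := exists_corner_le D x b hD
      exact ⟨p, q, hp, hq.trans hb.le, h⟩
  · push Not at hx
    obtain ⟨a, ha, hD⟩ := hx
    obtain ⟨p, q, hp, hq, h⟩ := exists_corner_le D a y hD
    exact ⟨p, q, hp.trans ha.le, hq, h⟩
termination_by x + y

/-- The area of an L-shape with corners bounded by `K` is at most `K ^ 2 / 3`. -/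
theorem three_mul_lShape_area_le {l h w y K : ℤ} (hw : 0 ≤ w) (hy : 0 ≤ y)
    (h₁ : l + h - w ≤ K) (h₂ : l + h - y ≤ K) (hwl : w ≤ l) (hyh : y ≤ h) :
    3 * (l * h - w * y) ≤ K ^ 2 := by
  obtain ⟨m, hm₀, hmw, hmy, hmK⟩ : ∃ m : ℤ, 0 ≤ m ∧ m ≤ w ∧ m ≤ y ∧ l + h - m ≤ K := by
    rcases le_total w y with hle | hle
    · exact ⟨w, hw, le_rfl, hle, h₁⟩
    · exact ⟨y, hy, hle, le_rfl, h₂⟩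
  have hmul : m * m ≤ w * y := mul_le_mul hmw hmy hm₀ hw
  have hsq : (l + h - m) ^ 2 ≤ K ^ 2 := pow_le_pow_left₀ (by omega) hmK 2
  nlinarith [sq_nonneg (l + h - 4 * m), sq_nonneg (l - h)]

/-- Counting by minimal representatives: a region containing all of them bounds the order. -/
theorem card_le_of_isMinRep_mem {Γ : Type*} [AddCommGroup Γ] [Fintype Γ] {γ₁ γ₂ : Γ}
    (hgen : ∀ g : Γ, ∃ a b : ℕ, g = a • γ₁ + b • γ₂) (S : Finset (ℕ × ℕ))
    (hS : ∀ x y, IsMinRep γ₁ γ₂ x y → (x, y) ∈ S) : Fintype.card Γ ≤ S.card := by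
  refine Finset.card_le_card_of_surjOn (fun v : ℕ × ℕ => v.1 • γ₁ + v.2 • γ₂)
    (s := S) (t := Finset.univ) ?_
  intro g _
  obtain ⟨a, b, rfl⟩ := hgen g
  obtain ⟨x, y, hxy, e⟩ := exists_isMinRep (γ₁ := γ₁) (γ₂ := γ₂) a b
  exact ⟨(x, y), hS x y hxy, e⟩

/-- Forcade–Lamoreaux, `Δ₂ = 1/3` upper bound: if every element of a
finite abelian group `Γ` of order `N` is a nonnegative combination `a₁γ₁ + a₂γ₂` with
`a₁ + a₂ ≤ k`, then `3N ≤ (k+2)²`, i.e. the density of any Abelian Cayley digraph of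
degree `2` is at most `1/3`. -/
theorem density_degree_two_le (Γ : Type*) [AddCommGroup Γ] [Fintype Γ] (γ₁ γ₂ : Γ)
    (k : ℕ) (h : ∀ g : Γ, ∃ a₁ a₂ : ℕ, g = a₁ • γ₁ + a₂ • γ₂ ∧ a₁ + a₂ ≤ k) :
    3 * Fintype.card Γ ≤ (k + 2)^2 := by
  have hgen : ∀ g : Γ, ∃ a b : ℕ, g = a • γ₁ + b • γ₂ := fun g =>
    let ⟨a, b, e, _⟩ := h g
    ⟨a, b, e⟩
  have hk : ∀ x y, IsMinRep γ₁ γ₂ x y → x + y ≤ k := by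
    intro x y hxy
    obtain ⟨a, b, e, hab⟩ := h (x • γ₁ + y • γ₂)
    have := hxy a b e.symm
    omega
  have h00 : IsMinRep γ₁ γ₂ 0 0 := by
    intro x y _
    omega
  obtain ⟨l, hl, hl'⟩ : ∃ l, ¬ IsMinRep γ₁ γ₂ (l + 1) 0 ∧ IsMinRep γ₁ γ₂ l 0 := by
    by_contra! H
    have hall : ∀ n, IsMinRep γ₁ γ₂ n 0 := fun n =>
      Nat.rec h00 (fun n hn => by_contra fun hn' => H n hn' hn) n
    have := hk _ _ (hall (k + 1))
    omega
  obtain ⟨m, hm, hm'⟩ : ∃ m, ¬ IsMinRep γ₁ γ₂ 0 (m + 1) ∧ IsMinRep γ₁ γ₂ 0 m := by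
    by_contra! H
    have hall : ∀ n, IsMinRep γ₁ γ₂ 0 n := fun n =>
      Nat.rec h00 (fun n hn => by_contra fun hn' => H n hn' hn) n
    have := hk _ _ (hall (k + 1))
    omega
  have hx : ∀ x y, IsMinRep γ₁ γ₂ x y → x < l + 1 := fun x y H => by
    by_contra! hle
    exact hl (H.mono hle (Nat.zero_le _))
  have hy : ∀ x y, IsMinRep γ₁ γ₂ x y → y < m + 1 := fun x y H => by
    by_contra! hle
    exact hm (H.mono (Nat.zero_le _) hle)
  have hcorner : ∀ x y, x ≤ l → y ≤ m → ¬ IsMinRep γ₁ γ₂ x y →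
      ∃ p q, p + 1 ≤ x ∧ q + 1 ≤ y ∧ ¬ IsMinRep γ₁ γ₂ (p + 1) (q + 1) ∧
        IsMinRep γ₁ γ₂ p (q + 1) ∧ IsMinRep γ₁ γ₂ (p + 1) q := by
    intro x y hxl hym hxy
    obtain ⟨p, q, hp, hq, hpq, hp', hq'⟩ := exists_corner_le _ x y hxy
    rcases p with _ | p
    · exact absurd (hm'.mono le_rfl (hq.trans hym)) hpq
    rcases q with _ | q
    · exact absurd (hl'.mono (hp.trans hxl) le_rfl) hpq
    exact ⟨p, q, hp, hq, hpq, hp' p p.lt_succ_self, hq' q q.lt_succ_self⟩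
  by_cases hfull : IsMinRep γ₁ γ₂ l m
  · have hcard := card_le_of_isMinRep_mem hgen (Finset.range (l + 1) ×ˢ Finset.range (m + 1))
      fun x y H => by
        rw [Finset.mem_product, Finset.mem_range, Finset.mem_range]
        exact ⟨hx x y H, hy x y H⟩
    rw [Finset.card_product, Finset.card_range, Finset.card_range] at hcard
    have hlm := hk _ _ hfull
    nlinarith [sq_nonneg ((l : ℤ) - m), Nat.pow_le_pow_left (show l + m + 2 ≤ k + 2 by omega) 2]
  · obtain ⟨p, q, hpl, hqm, hpq, hp, hq⟩ := hcorner l m le_rfl le_rfl hfull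
    have hright : IsMinRep γ₁ γ₂ l q := by
      by_contra H
      obtain ⟨r, s, hrl, hsq, hrs, hr, hs⟩ := hcorner l q le_rfl (by omega) H
      have hrp := corner_fst_le hpq hp hq hrs hr hs
      exact hrs (hq.mono (by omega) (by omega))
    have htop : IsMinRep γ₁ γ₂ p m := by
      by_contra H
      obtain ⟨r, s, hrp, hsm, hrs, hr, hs⟩ := hcorner p m (by omega) le_rfl H
      have hpr := corner_fst_le hrs hr hs hpq hp hq
      omega
    have hsub : Finset.Ico (p + 1) (l + 1) ×ˢ Finset.Ico (q + 1) (m + 1) ⊆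
        Finset.range (l + 1) ×ˢ Finset.range (m + 1) := by
      refine Finset.product_subset_product ?_ ?_ <;> intro i hi <;>
        rw [Finset.mem_Ico] at hi <;> exact Finset.mem_range.2 hi.2
    have hcard := card_le_of_isMinRep_mem hgen
      ((Finset.range (l + 1) ×ˢ Finset.range (m + 1)) \
        (Finset.Ico (p + 1) (l + 1) ×ˢ Finset.Ico (q + 1) (m + 1)))
      fun x y H => by
        simp only [Finset.mem_sdiff, Finset.mem_product, Finset.mem_range, Finset.mem_Ico]
        exact ⟨⟨hx x y H, hy x y H⟩, fun H' => hpq (H.mono H'.1.1 H'.2.1)⟩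
    have hadd := Finset.card_sdiff_add_card_eq_card hsub
    simp only [Finset.card_product, Finset.card_range, Nat.card_Ico] at hadd
    have hlq := hk _ _ hright
    have hpm := hk _ _ htop
    obtain ⟨w, rfl⟩ := Nat.exists_eq_add_of_le hpl
    obtain ⟨y, rfl⟩ := Nat.exists_eq_add_of_le hqm
    rw [show p + 1 + w + 1 - (p + 1) = w + 1 by omega,
      show q + 1 + y + 1 - (q + 1) = y + 1 by omega] at hadd
    have harea := three_mul_lShape_area_le (l := p + 1 + w + 1) (h := q + 1 + y + 1)
      (w := w + 1) (y := y + 1) (K := k + 2) (by omega) (by omega) (by omega) (by omega)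
      (by omega) (by omega)
    zify at hadd hcard ⊢
    linarith
end

section
/- Let Γ be a finite abelian group of order N and let γ₁, γ₂, γ₃ ∈ Γ be such that the Cayley digraph Cay(Γ, {γ₁, γ₂, γ₃}) has diameter k. Then 25N ≤ 3(k + 3)³; equivalently, the density N/(k+3)³ of any Abelian Cayley digraph of degree 3 is at most 3/25. -/
namespace AbelianCayley

open Finset

/-- The nonnegative part of `u (2l - u)`. -/
noncomputable def bump (l u : ℝ) : ℝ := max (u * (2 * l - u)) 0

lemma bump_nonneg (l u : ℝ) : 0 ≤ bump l u := le_max_right _ _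

lemma le_bump (l u : ℝ) : u * (2 * l - u) ≤ bump l u := le_max_left _ _

lemma bump_le_sq (l u : ℝ) : bump l u ≤ l ^ 2 :=
  max_le (by nlinarith [sq_nonneg (u - l)]) (sq_nonneg l)

/-- The contribution of the step of the staircase `f` between the columns `x` and `x + 1`. -/
noncomputable def stepGain (l t : ℝ) (f : ℕ → ℕ) (x : ℕ) : ℝ :=
  bump l (t - (x + 1) - f (x + 1)) - bump l (t - (x + 1) - f x)

lemma stepGain_le_sq (l t : ℝ) (f : ℕ → ℕ) (x : ℕ) : stepGain l t f x ≤ l ^ 2 := by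
  unfold stepGain
  linarith [bump_le_sq l (t - (x + 1) - f (x + 1)), bump_nonneg l (t - (x + 1) - f x)]

lemma bump_sub_bump_ge (l a : ℝ) (ha : 1 ≤ a) :
    1 - 2 * a + 2 * l ≤ bump l a - bump l (a - 1) := by
  rcases le_total (a - 1) (2 * l) with h | h
  · have h1 : bump l (a - 1) = (a - 1) * (2 * l - (a - 1)) :=
      max_eq_left (mul_nonneg (by linarith) (by linarith))
    nlinarith [le_bump l a]
  · have h1 : bump l (a - 1) = 0 :=
      max_eq_right (mul_nonpos_of_nonneg_of_nonpos (by linarith) (by linarith))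
    linarith [bump_nonneg l a]

/-- Area bound for a staircase inside a right isosceles triangle of leg `t`. -/
lemma two_mul_sum_le (l t : ℝ) (f : ℕ → ℕ)
    (hf : ∀ x, 0 < f x → (x : ℝ) + 1 + f x ≤ t) (n : ℕ) (hpos : ∀ x < n, 0 < f x) :
    2 * ∑ x ∈ range n, (f x : ℝ) + (t - n) ^ 2 - 2 * l * (t - n) + bump l (t - n - f n) ≤
      t ^ 2 - 2 * l * t + bump l (t - f 0) + ∑ x ∈ range n, stepGain l t f x := by
  induction n with
  | zero => simp
  | succ n ih =>
    have ih := ih fun x hx => hpos x (by omega)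
    have h1 := hf n (hpos n (by omega))
    have h2 := bump_sub_bump_ge l (t - n - f n) (by linarith)
    rw [sum_range_succ, sum_range_succ]
    unfold stepGain at ih ⊢
    have e : t - n - f n - 1 = t - (n + 1) - f n := by ring
    rw [e] at h2
    push_cast
    nlinarith

/-- The columns to the left of an inner corner of the staircase `f`. -/
def corners (f : ℕ → ℕ) (m : ℕ) : Finset ℕ :=
  (range m).filter fun x => 0 < f (x + 1) ∧ f (x + 1) < f x

lemma two_mul_sum_le_corners (l t : ℝ) (f : ℕ → ℕ) (hanti : Antitone f)
    (hf : ∀ x, 0 < f x → (x : ℝ) + 1 + f x ≤ t) (m : ℕ) (hm : f m = 0) :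
    2 * ∑ x ∈ range m, (f x : ℝ) ≤
      t ^ 2 - 2 * l * t + 2 * l ^ 2 + ∑ x ∈ corners f m, stepGain l t f x := by
  classical
  have hex : ∃ n, f n = 0 := ⟨m, hm⟩
  obtain ⟨n, hn, hpos, hnm⟩ : ∃ n, f n = 0 ∧ (∀ x < n, 0 < f x) ∧ n ≤ m :=
    ⟨Nat.find hex, Nat.find_spec hex, fun x hx => Nat.pos_of_ne_zero (Nat.find_min hex hx),
      Nat.find_min' hex hm⟩
  have hzero : ∀ x, n ≤ x → f x = 0 := fun x hx => Nat.le_zero.mp (hn ▸ hanti hx)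
  have hsum : ∑ x ∈ range m, (f x : ℝ) = ∑ x ∈ range n, (f x : ℝ) := by
    symm
    apply sum_subset (range_subset_range.mpr hnm)
    intro x _ hx
    simp [hzero x (by simpa using hx)]
  have hcor : corners f m = (range (n - 1)).filter fun x => 0 < f (x + 1) ∧ f (x + 1) < f x := by
    ext x
    simp only [corners, mem_filter, mem_range]
    constructor
    · rintro ⟨_, h1, h2⟩
      refine ⟨?_, h1, h2⟩
      by_contra h
      have := hzero (x + 1) (by omega)
      omega
    · rintro ⟨h, h1, h2⟩
      exact ⟨by omega, h1, h2⟩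
  have hgain : ∑ x ∈ corners f m, stepGain l t f x = ∑ x ∈ range (n - 1), stepGain l t f x := by
    rw [hcor]
    apply sum_filter_of_ne
    intro x hx hne
    rw [mem_range] at hx
    refine ⟨hpos _ (by omega), lt_of_le_of_ne (hanti (Nat.le_succ x)) fun h => hne ?_⟩
    simp only [stepGain]
    rw [h, sub_self]
  rw [hsum, hgain]
  rcases Nat.eq_zero_or_pos n with rfl | hn0
  · simp only [range_zero, sum_empty, zero_le, Nat.sub_eq_zero_of_le]
    nlinarith [sq_nonneg (t - l), sq_nonneg l]
  · have h := two_mul_sum_le l t f hf n hpos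
    obtain ⟨j, rfl⟩ : ∃ j, n = j + 1 := ⟨n - 1, by omega⟩
    rw [sum_range_succ (stepGain l t f)] at h
    rw [hn] at h
    have h3 := le_bump l (t - ((j + 1 : ℕ) : ℝ) - ((0 : ℕ) : ℝ))
    have h4 := bump_le_sq l (t - f 0)
    have h5 := stepGain_le_sq l t f j
    simp only [Nat.add_sub_cancel]
    push_cast at *
    nlinarith

/-- Area bound for a staircase, with a penalty for every inner corner. -/
lemma two_mul_sum_le_penalty (l t : ℝ) (hl : 0 ≤ l) (ht : 0 ≤ t) (f : ℕ → ℕ) (hanti : Antitone f)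
    (hf : ∀ x, 0 < f x → (x : ℝ) + 1 + f x ≤ t) (m : ℕ) (hm : f m = 0) :
    2 * ∑ x ∈ range m, (f x : ℝ) ≤
      t ^ 2 / 2 + (max (t - 2 * l) 0) ^ 2 / 2 + 3 / 4 * l ^ 2 * #(corners f m) +
        ∑ x ∈ corners f m, max (stepGain l t f x - 3 / 4 * l ^ 2) 0 := by
  rcases le_total t (2 * l) with h | h
  · rw [max_eq_right (by linarith : t - 2 * l ≤ 0)]
    have hP : 0 ≤ ∑ x ∈ corners f m, max (stepGain l t f x - 3 / 4 * l ^ 2) 0 :=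
      sum_nonneg fun _ _ => le_max_right _ _
    have key : ∀ l' : ℝ, 2 * ∑ x ∈ range m, (f x : ℝ) ≤
        t ^ 2 - 2 * l' * t + 2 * l' ^ 2 + #(corners f m) * l' ^ 2 := by
      intro l'
      refine (two_mul_sum_le_corners l' t f hanti hf m hm).trans ?_
      gcongr
      rw [← nsmul_eq_mul]
      exact sum_le_card_nsmul _ _ _ fun x _ => stepGain_le_sq l' t f x
    rcases Nat.eq_zero_or_pos #(corners f m) with h0 | h0
    · have := key (t / 2)
      rw [h0] at this ⊢
      push_cast at *
      nlinarith
    · have h1 : (1 : ℝ) ≤ #(corners f m) := by exact_mod_cast h0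
      have := key (t / 3)
      have h2 : t ^ 2 ≤ 4 * l ^ 2 := by nlinarith
      nlinarith [mul_le_mul_of_nonneg_right h1 (sq_nonneg t),
        mul_le_mul_of_nonneg_left h2 (by linarith : (0 : ℝ) ≤ #(corners f m)), sq_nonneg l]
  · rw [max_eq_left (by linarith : 0 ≤ t - 2 * l)]
    have h1 := two_mul_sum_le_corners l t f hanti hf m hm
    have h2 : ∑ x ∈ corners f m, stepGain l t f x ≤ 3 / 4 * l ^ 2 * #(corners f m) +
        ∑ x ∈ corners f m, max (stepGain l t f x - 3 / 4 * l ^ 2) 0 := by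
      rw [mul_comm, ← nsmul_eq_mul, ← sum_const, ← sum_add_distrib]
      exact sum_le_sum fun x _ => by linarith [le_max_left (stepGain l t f x - 3 / 4 * l ^ 2) 0]
    nlinarith

/-- An upper bound for the excess of the gain over the penalty at a corner of depth `a` whose
height is at most `n`. -/
noncomputable def edgeExcess (l : ℝ) (n a : ℕ) : ℝ :=
  if a ≤ n then max (2 * l * a - a ^ 2 - 3 / 4 * l ^ 2) 0
  else max (2 * l * n - n ^ 2 - 3 / 4 * l ^ 2 - 2 * n * (a - n)) 0

lemma edgeExcess_nonneg (l : ℝ) (n a : ℕ) : 0 ≤ edgeExcess l n a := by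
  unfold edgeExcess
  split_ifs <;> exact le_max_right _ _

lemma bump_sub_bump_sub_le (l : ℝ) (n a d : ℕ) (hdn : d ≤ n) (hda : d ≤ a) :
    max (bump l a - bump l (a - d) - 3 / 4 * l ^ 2) 0 ≤ edgeExcess l n a := by
  refine max_le ?_ (edgeExcess_nonneg l n a)
  have hdn' : (d : ℝ) ≤ n := by exact_mod_cast hdn
  have hda' : (d : ℝ) ≤ a := by exact_mod_cast hda
  have hd0 : (0 : ℝ) ≤ d := Nat.cast_nonneg d
  rcases le_total (2 * l) a with h | h
  · have h1 : bump l a = 0 :=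
      max_eq_right (mul_nonpos_of_nonneg_of_nonpos (by linarith) (by linarith))
    nlinarith [edgeExcess_nonneg l n a, bump_nonneg l (a - d), sq_nonneg l]
  · have h1 : bump l a = a * (2 * l - a) :=
      max_eq_left (mul_nonneg (by linarith) (by linarith))
    unfold edgeExcess
    split_ifs with han
    · refine le_max_of_le_left ?_
      nlinarith [bump_nonneg l (a - d)]
    · have h2 := le_bump l (a - d)
      rcases le_total (2 * l - 2 * a + n) 0 with h3 | h3
      · refine le_max_of_le_right ?_
        nlinarith [sq_nonneg l, mul_nonneg hd0 (by linarith : 0 ≤ -(2 * l - 2 * a + d))]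
      · refine le_max_of_le_left ?_
        nlinarith [mul_nonneg (sub_nonneg.mpr hdn') h3, mul_nonneg (sub_nonneg.mpr hdn') hd0]

/-- `u - l / 2` clamped to the interval `[0, l]`. -/
noncomputable def clamp (l u : ℝ) : ℝ := max 0 (min l (u - l / 2))

lemma sum_edgeExcess_le_of_le (l : ℝ) (hl : 0 ≤ l) (n m : ℕ) (hm : m ≤ n) :
    ∑ i ∈ range m, edgeExcess l n (i + 1) ≤
      l * clamp l m ^ 2 / 2 - clamp l m ^ 3 / 3 + l * clamp l m := by
  induction m with
  | zero =>
    have : clamp l 0 = 0 := max_eq_left ((min_le_right _ _).trans (by linarith))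
    simp [this]
  | succ m ih =>
    have ih := ih (by omega)
    rw [sum_range_succ]
    have hex : edgeExcess l n (m + 1) ≤ clamp l (m + 1 : ℕ) * (l - clamp l (m + 1 : ℕ)) := by
      unfold edgeExcess clamp
      rw [if_pos hm]
      rcases le_total l ((m + 1 : ℕ) - l / 2) with h | h
      · rw [min_eq_left h, max_eq_right hl, sub_self, mul_zero]
        exact max_le (by nlinarith) le_rfl
      · rw [min_eq_right h]
        rcases le_total 0 (((m + 1 : ℕ) : ℝ) - l / 2) with h' | h'
        · rw [max_eq_right h']
          exact max_le (by nlinarith) (mul_nonneg h' (by linarith))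
        · rw [max_eq_left h', zero_mul]
          exact max_le (by nlinarith) le_rfl
    have hw0 : 0 ≤ clamp l m := le_max_left _ _
    have hstep : (clamp l (m + 1 : ℕ) = l ∧ clamp l m ≤ l) ∨ clamp l (m + 1 : ℕ) = clamp l m + 1 ∨
        (clamp l m = 0 ∧ 0 ≤ clamp l (m + 1 : ℕ) ∧ clamp l (m + 1 : ℕ) ≤ 1 ∧
          clamp l (m + 1 : ℕ) ≤ l) := by
      unfold clamp
      push_cast
      grind
    generalize clamp l (m + 1 : ℕ) = w at *
    generalize clamp l m = v at *
    rcases hstep with ⟨rfl, h⟩ | rfl | ⟨rfl, h1, h2, h3⟩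
    · nlinarith [mul_nonneg (mul_nonneg hw0 hw0) (sub_nonneg.mpr h),
        mul_nonneg (sub_nonneg.mpr h) (mul_nonneg hw0 hl), mul_nonneg (sub_nonneg.mpr h) (sq_nonneg w),
        mul_nonneg hl (sq_nonneg (w - v)), mul_nonneg (sub_nonneg.mpr h) hl]
    · nlinarith
    · nlinarith [mul_nonneg h1 h1, mul_nonneg (mul_nonneg h1 h1) (sub_nonneg.mpr h3)]

lemma sum_edgeExcess_tail_le (l : ℝ) (n : ℕ) (hn : 0 < n) (j : ℕ) :
    ∑ i ∈ range j, edgeExcess l n (n + i + 1) ≤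
      ((max (2 * l * n - n ^ 2 - 3 / 4 * l ^ 2) 0) ^ 2 -
        (max (2 * l * n - n ^ 2 - 3 / 4 * l ^ 2 - 2 * n * j) 0) ^ 2) / (4 * n) := by
  have hn' : (0 : ℝ) < n := by exact_mod_cast hn
  generalize hz : 2 * l * n - (n : ℝ) ^ 2 - 3 / 4 * l ^ 2 = z
  induction j with
  | zero => simp
  | succ j ih =>
    rw [sum_range_succ]
    have hex : edgeExcess l n (n + j + 1) ≤
        ((max (z - 2 * n * j) 0) ^ 2 - (max (z - 2 * n * (j + 1)) 0) ^ 2) / (4 * n) := by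
      unfold edgeExcess
      rw [if_neg (by omega), hz, le_div_iff₀ (by positivity)]
      push_cast
      have e : z - 2 * n * (n + j + 1 - n) = z - 2 * n * (j + 1 : ℝ) := by ring
      rw [e]
      rcases le_total 0 (z - 2 * n * (j + 1 : ℝ)) with h | h
      · rw [max_eq_left h, max_eq_left (by nlinarith)]
        nlinarith
      · rw [max_eq_right h]
        nlinarith [sq_nonneg (max (z - 2 * n * j) 0)]
    push_cast
    calc _ ≤ _ := add_le_add ih hex
      _ = _ := by ring

lemma sum_edgeExcess_le (l : ℝ) (hl : 0 < l) (n m : ℕ) (hn : 0 < n) :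
    ∑ i ∈ range m, edgeExcess l n (i + 1) ≤ (l ^ 2 / 8 + l) * n := by
  have hn' : (0 : ℝ) < n := by exact_mod_cast hn
  have hmono : ∑ i ∈ range m, edgeExcess l n (i + 1) ≤
      ∑ i ∈ range (n + m), edgeExcess l n (i + 1) :=
    sum_le_sum_of_subset_of_nonneg (range_subset_range.mpr (by omega))
      fun i _ _ => edgeExcess_nonneg l n _
  refine hmono.trans ?_
  rw [sum_range_add]
  have h1 := sum_edgeExcess_le_of_le l hl.le n n le_rfl
  have h2 : ∑ i ∈ range m, edgeExcess l n (n + i + 1) ≤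
      (max (2 * l * n - n ^ 2 - 3 / 4 * l ^ 2) 0) ^ 2 / (4 * n) := by
    refine (sum_edgeExcess_tail_le l n hn m).trans ?_
    gcongr
    linarith [sq_nonneg (max (2 * l * n - n ^ 2 - 3 / 4 * l ^ 2 - 2 * n * m) 0)]
  refine (add_le_add h1 h2).trans ?_
  unfold clamp
  rcases le_total (n : ℝ) (l / 2) with h | h
  · rw [max_eq_left ((min_le_right _ _).trans (by linarith)), max_eq_right (by nlinarith)]
    simp only [ne_eq, OfNat.ofNat_ne_zero, not_false_eq_true, zero_pow, mul_zero, zero_div]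
    have : 0 ≤ (l ^ 2 / 8 + l) * n := by positivity
    linarith
  · rcases le_total l (n - l / 2) with h' | h'
    · rw [min_eq_left h', max_eq_right hl.le, max_eq_right (by nlinarith)]
      simp only [ne_eq, OfNat.ofNat_ne_zero, not_false_eq_true, zero_pow, zero_div]
      nlinarith [mul_le_mul_of_nonneg_left h' (sq_nonneg l), mul_le_mul_of_nonneg_left h' hl.le,
        pow_pos hl 3]
    · rw [min_eq_right h', max_eq_right (by linarith), max_eq_left (by nlinarith)]
      obtain ⟨v, hv⟩ : ∃ v : ℝ, (n : ℝ) = l * (v + 1 / 2) := ⟨n / l - 1 / 2, by field_simp; ring⟩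
      have hv0 : 0 ≤ v := by nlinarith
      have hv1 : v ≤ 1 := by nlinarith
      have hquot : (2 * l * n - (n : ℝ) ^ 2 - 3 / 4 * l ^ 2) ^ 2 / (4 * n) =
          l ^ 3 * ((v * (1 - v)) ^ 2 / (4 * v + 2)) := by
        rw [hv]
        field_simp
        ring
      have hpoly : v ^ 2 / 2 - v ^ 3 / 3 + (v * (1 - v)) ^ 2 / (4 * v + 2) ≤ (v + 1 / 2) / 8 := by
        have : (v * (1 - v)) ^ 2 / (4 * v + 2) ≤ (v + 1 / 2) / 8 - (v ^ 2 / 2 - v ^ 3 / 3) := by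
          rw [div_le_iff₀ (by linarith)]
          nlinarith [sq_nonneg (v - 77 / 100), sq_nonneg (v ^ 2 - 3 / 5),
            mul_nonneg hv0 (sq_nonneg (v - 77 / 100)), sq_nonneg (v * (v - 77 / 100))]
        linarith
      rw [hquot, hv]
      have hl3 : 0 < l ^ 3 := pow_pos hl 3
      nlinarith [mul_le_mul_of_nonneg_left hpoly hl3.le, sq_nonneg l]

lemma sum_edgeExcess_diag_le (l : ℝ) (hl : 0 < l) (n : ℕ) :
    ∑ i ∈ range n, edgeExcess l n (i + 1) ≤ l ^ 3 / 6 + l ^ 2 := by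
  refine (sum_edgeExcess_le_of_le l hl.le n n le_rfl).trans ?_
  have h0 : 0 ≤ clamp l n := le_max_left _ _
  have h1 : clamp l n ≤ l := max_le hl.le (min_le_left _ _)
  generalize clamp l n = w at *
  nlinarith [mul_nonneg (sq_nonneg (l - w)) (by linarith : 0 ≤ l + 2 * w)]

lemma max_stepGain_le (l : ℝ) (f : ℕ → ℕ) (k c x n a : ℕ) (hanti : f (x + 1) ≤ f x)
    (ha : c + x + f (x + 1) + a = k + 1) (hsize : c + x + f x ≤ k + 1)
    (hn : f x ≤ n + f (x + 1)) :
    max (stepGain l (k + 2 - c) f x - 3 / 4 * l ^ 2) 0 ≤ edgeExcess l n a := by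
  obtain ⟨d, hd⟩ := Nat.exists_eq_add_of_le hanti
  have ha' : (c : ℝ) + x + f (x + 1) + a = k + 1 := by exact_mod_cast ha
  have hd' : (f x : ℝ) = f (x + 1) + d := by exact_mod_cast hd
  have h := bump_sub_bump_sub_le l n a d (by omega) (by omega)
  unfold stepGain
  rwa [show (k + 2 - c - (x + 1) - f (x + 1) : ℝ) = a by linarith,
    show (k + 2 - c - (x + 1) - f x : ℝ) = a - d by linarith]

lemma sum_edgeExcess_comp_le {ι : Type*} (l : ℝ) (n m : ℕ) (S : Finset ι) (a : ι → ℕ)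
    (hinj : Set.InjOn a S) (ha : ∀ i ∈ S, 0 < a i ∧ a i ≤ m) :
    ∑ i ∈ S, edgeExcess l n (a i) ≤ ∑ i ∈ range m, edgeExcess l n (i + 1) := by
  classical
  have e : ∑ i ∈ S, edgeExcess l n (a i) =
      ∑ j ∈ S.image fun i => a i - 1, edgeExcess l n (j + 1) := by
    rw [sum_image]
    · exact sum_congr rfl fun i hi => by rw [Nat.sub_add_cancel (ha i hi).1]
    · intro i hi j hj hij
      have h1 := ha i hi
      have h2 := ha j hj
      exact hinj hi hj (by simp only at hij; omega)
  rw [e]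
  refine sum_le_sum_of_subset_of_nonneg ?_ fun j _ _ => edgeExcess_nonneg l n _
  intro j hj
  obtain ⟨i, hi, rfl⟩ := mem_image.mp hj
  have := ha i hi
  exact mem_range.mpr (by omega)

lemma sum_sq_le (k : ℕ) :
    ∑ c ∈ range (k + 1), ((k : ℝ) + 2 - c) ^ 2 ≤ ((k : ℝ) + 2) * (k + 3) * (2 * k + 5) / 6 := by
  have h := sum_range_sub' (fun c : ℕ =>
    ((k : ℝ) + 2 - c) * (k + 3 - c) * (2 * (k + 3 - c) - 1) / 6) (k + 1)
  calc _ = _ := sum_congr rfl fun c _ => by push_cast; ring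
    _ = _ := h
    _ ≤ _ := by
      push_cast
      ring_nf
      linarith

lemma sum_max_sq_le (l : ℝ) (k : ℕ) (hl : 2 * l ≤ k + 3) :
    ∑ c ∈ range (k + 1), (max ((k : ℝ) + 2 - c - 2 * l) 0) ^ 2 ≤ (k + 3 - 2 * l) ^ 3 / 3 := by
  have h := sum_range_sub' (fun c : ℕ => (max ((k : ℝ) + 3 - c - 2 * l) 0) ^ 3 / 3) (k + 1)
  have h0 : 0 ≤ (max ((k : ℝ) + 3 - (k + 1 : ℕ) - 2 * l) 0) ^ 3 / 3 := by positivity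
  have h1 : max ((k : ℝ) + 3 - (0 : ℕ) - 2 * l) 0 = k + 3 - 2 * l := by
    rw [max_eq_left] <;> push_cast <;> linarith
  calc _ ≤ _ := sum_le_sum fun c _ => ?_
    _ = _ := h
    _ ≤ _ := by rw [h1]; linarith
  push_cast
  rw [show (k : ℝ) + 3 - (c + 1) - 2 * l = k + 2 - c - 2 * l by ring,
    show (k : ℝ) + 3 - c - 2 * l = k + 2 - c - 2 * l + 1 by ring]
  generalize (k : ℝ) + 2 - c - 2 * l = v
  rcases le_total 0 v with hv | hv
  · rw [max_eq_left hv, max_eq_left (by linarith)]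
    nlinarith
  · rw [max_eq_right hv]
    have : 0 ≤ (max (v + 1) 0) ^ 3 / 3 := by positivity
    linarith

lemma excess_sum_flush_le (l : ℝ) (hl : 0 < l) (k : ℕ) (f : ℕ → ℕ → ℕ)
    (hx : ∀ c, Antitone (f c)) (hc : ∀ x, Antitone fun c => f c x)
    (hsize : ∀ c x, 0 < f c x → c + x + f c x ≤ k + 1) :
    ∑ c ∈ range (k + 1), ∑ x ∈ corners (f c) (k + 1) with f c (x + 1) = f 0 (x + 1),
      max (stepGain l (k + 2 - c) (f c) x - 3 / 4 * l ^ 2) 0 ≤ (l ^ 2 / 8 + l) * (k + 1) := by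
  classical
  have hcomm : ∑ c ∈ range (k + 1), ∑ x ∈ corners (f c) (k + 1) with f c (x + 1) = f 0 (x + 1),
      max (stepGain l (k + 2 - c) (f c) x - 3 / 4 * l ^ 2) 0 =
      ∑ x ∈ range (k + 1), ∑ c ∈ range (k + 1) with
        (x ∈ corners (f c) (k + 1) ∧ f c (x + 1) = f 0 (x + 1)),
        max (stepGain l (k + 2 - c) (f c) x - 3 / 4 * l ^ 2) 0 := by
    apply sum_comm'
    intro c x
    simp only [corners, mem_filter, mem_range]
    tauto
  rw [hcomm]
  have hcol : ∀ x ∈ range (k + 1), ∑ c ∈ range (k + 1) with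
        (x ∈ corners (f c) (k + 1) ∧ f c (x + 1) = f 0 (x + 1)),
        max (stepGain l (k + 2 - c) (f c) x - 3 / 4 * l ^ 2) 0 ≤
      (l ^ 2 / 8 + l) * (f 0 x - f 0 (x + 1)) := by
    intro x _
    obtain ⟨n, hn⟩ := Nat.exists_eq_add_of_le (hx 0 (Nat.le_succ x))
    rw [Nat.succ_eq_add_one] at hn
    have hn' : (f 0 x : ℝ) - f 0 (x + 1) = n := by
      rw [hn]
      push_cast
      ring
    rw [hn']
    have hmem : ∀ c ∈ (range (k + 1)).filter fun c =>
        x ∈ corners (f c) (k + 1) ∧ f c (x + 1) = f 0 (x + 1),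
        f 0 (x + 1) < f c x ∧ c + x + f c x ≤ k + 1 ∧ f c (x + 1) = f 0 (x + 1) ∧
          f c x ≤ f 0 x := by
      intro c hmem
      simp only [corners, mem_filter, mem_range] at hmem
      obtain ⟨_, ⟨_, h1, h2⟩, h3⟩ := hmem
      exact ⟨h3 ▸ h2, hsize c x (by omega), h3, hc x (Nat.zero_le c)⟩
    rcases Nat.eq_zero_or_pos n with rfl | hpos
    · rw [sum_eq_zero fun c hmem' => ?_]
      · simp
      · have := hmem c hmem'
        omega
    refine (sum_le_sum fun c hmem' => ?_).trans
      ((sum_edgeExcess_comp_le l n (k + 1) _ (fun c => k + 1 - x - f 0 (x + 1) - c) ?_ ?_).trans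
        (sum_edgeExcess_le l hl n (k + 1) hpos))
    · have := hmem c hmem'
      apply max_stepGain_le <;> omega
    · intro c h1 c' h2 h
      have := hmem c h1
      have := hmem c' h2
      beta_reduce at h
      omega
    · intro c h1
      have := hmem c h1
      omega
  refine (sum_le_sum hcol).trans ?_
  rw [← mul_sum, sum_range_sub' fun x => (f 0 x : ℝ)]
  have h0 : f 0 0 ≤ k + 1 := by
    rcases Nat.eq_zero_or_pos (f 0 0) with h | h
    · omega
    · have := hsize 0 0 h
      omega
  have h0' : (f 0 0 : ℝ) ≤ k + 1 := by exact_mod_cast h0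
  have : (0 : ℝ) ≤ f 0 (k + 1) := Nat.cast_nonneg _
  exact mul_le_mul_of_nonneg_left (by linarith) (by positivity)

lemma excess_sum_overhang_le (l : ℝ) (hl : 0 < l) (k : ℕ) (f : ℕ → ℕ → ℕ)
    (hsize : ∀ c x, 0 < f c x → c + x + f c x ≤ k + 1)
    (huniq : ∀ c c' x x', x ∈ corners (f c) (k + 1) → x' ∈ corners (f c') (k + 1) →
      f c (x + 1) ≠ f 0 (x + 1) → f c' (x' + 1) ≠ f 0 (x' + 1) →
      x = x' ∧ f c (x + 1) = f c' (x' + 1)) :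
    ∑ c ∈ range (k + 1), ∑ x ∈ corners (f c) (k + 1) with ¬ f c (x + 1) = f 0 (x + 1),
      max (stepGain l (k + 2 - c) (f c) x - 3 / 4 * l ^ 2) 0 ≤ l ^ 3 / 6 + l ^ 2 := by
  rw [sum_sigma']
  refine (sum_le_sum fun p hp => ?_).trans
    ((sum_edgeExcess_comp_le l (k + 1) (k + 1) _
      (fun p : (_ : ℕ) × ℕ => k + 1 - p.2 - f p.1 (p.2 + 1) - p.1) ?_ ?_).trans
        (sum_edgeExcess_diag_le l hl (k + 1)))
  · simp only [corners, mem_sigma, mem_filter, mem_range] at hp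
    have := hsize p.1 p.2 (by omega)
    apply max_stepGain_le <;> omega
  · rintro ⟨c, x⟩ h1 ⟨c', x'⟩ h2 h
    simp only [mem_coe, mem_sigma, mem_filter] at h1 h2 h
    obtain ⟨rfl, hy⟩ := huniq c c' x x' h1.2.1 h2.2.1 h1.2.2 h2.2.2
    simp only [corners, mem_filter] at h1 h2
    have := hsize c x (by omega)
    have := hsize c' x (by omega)
    obtain rfl : c = c' := by omega
    rfl
  · intro p hp
    simp only [corners, mem_sigma, mem_filter, mem_range] at hp
    have := hsize p.1 p.2 (by omega)
    omega

/-- Volume bound for a three-dimensional staircase with few inner corners, given by the heights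
`f c x` of its columns. -/
lemma volume_le (k : ℕ) (f : ℕ → ℕ → ℕ)
    (hx : ∀ c, Antitone (f c)) (hc : ∀ x, Antitone fun c => f c x)
    (hsize : ∀ c x, 0 < f c x → c + x + f c x ≤ k + 1)
    (hcard : ∑ c ∈ range (k + 1), #(corners (f c) (k + 1)) ≤ k + 1)
    (huniq : ∀ c c' x x', x ∈ corners (f c) (k + 1) → x' ∈ corners (f c') (k + 1) →
      f c (x + 1) ≠ f 0 (x + 1) → f c' (x' + 1) ≠ f 0 (x' + 1) →
      x = x' ∧ f c (x + 1) = f c' (x' + 1)) :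
    25 * ∑ c ∈ range (k + 1), ∑ x ∈ range (k + 1), f c x ≤ 3 * (k + 3) ^ 3 := by
  obtain ⟨l, hl⟩ : ∃ l : ℝ, (k : ℝ) + 3 = 5 * l := ⟨(k + 3) / 5, by ring⟩
  have hk : (k : ℝ) = 5 * l - 3 := by linarith
  have hl0 : 0 < l := by
    have : (0 : ℝ) ≤ k := Nat.cast_nonneg k
    linarith
  have hlayer : ∀ c ∈ range (k + 1), 2 * ∑ x ∈ range (k + 1), (f c x : ℝ) ≤
      ((k : ℝ) + 2 - c) ^ 2 / 2 + (max ((k : ℝ) + 2 - c - 2 * l) 0) ^ 2 / 2 +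
        3 / 4 * l ^ 2 * #(corners (f c) (k + 1)) +
        ∑ x ∈ corners (f c) (k + 1),
          max (stepGain l (k + 2 - c) (f c) x - 3 / 4 * l ^ 2) 0 := by
    intro c hc'
    refine two_mul_sum_le_penalty l _ hl0.le ?_ _ (hx c) (fun x h => ?_) _ ?_
    · have : (c : ℝ) < (k + 1 : ℕ) := by exact_mod_cast mem_range.mp hc'
      push_cast at this
      linarith
    · have : (c : ℝ) + x + f c x ≤ k + 1 := by exact_mod_cast hsize c x h
      linarith
    · by_contra h
      have := hsize c (k + 1) (Nat.pos_of_ne_zero h)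
      omega
  have hsum := sum_le_sum hlayer
  simp only [sum_add_distrib, ← mul_sum, ← sum_div] at hsum
  have hsplit := sum_congr (rfl : range (k + 1) = range (k + 1)) fun c _ =>
    (sum_filter_add_sum_filter_not (corners (f c) (k + 1))
      (fun x => f c (x + 1) = f 0 (x + 1))
      fun x => max (stepGain l (k + 2 - c) (f c) x - 3 / 4 * l ^ 2) 0).symm
  rw [sum_add_distrib] at hsplit
  have h1 := excess_sum_flush_le l hl0 k f hx hc hsize
  have h2 := excess_sum_overhang_le l hl0 k f hsize huniq
  have h3 := sum_sq_le k
  have h4 := sum_max_sq_le l k (by linarith)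
  have h5 : (∑ c ∈ range (k + 1), (#(corners (f c) (k + 1)) : ℝ)) ≤ k + 1 := by
    exact_mod_cast hcard
  have h6 := mul_le_mul_of_nonneg_left h5 (by positivity : 0 ≤ 3 / 4 * l ^ 2)
  have hV : 2 * ∑ c ∈ range (k + 1), ∑ x ∈ range (k + 1), (f c x : ℝ) ≤
      ((k : ℝ) + 2) * (k + 3) * (2 * k + 5) / 12 + (k + 3 - 2 * l) ^ 3 / 6 +
        3 / 4 * l ^ 2 * (k + 1) + (l ^ 2 / 8 + l) * (k + 1) + (l ^ 3 / 6 + l ^ 2) := by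
    linarith
  have key : 25 * ∑ c ∈ range (k + 1), ∑ x ∈ range (k + 1), (f c x : ℝ) ≤
      3 * ((k : ℝ) + 3) ^ 3 := by
    generalize ∑ c ∈ range (k + 1), ∑ x ∈ range (k + 1), (f c x : ℝ) = V at *
    rw [hk] at hV ⊢
    nlinarith [pow_pos hl0 2, pow_pos hl0 3]
  exact_mod_cast key

/-- The graded lexicographic order on exponent triples. -/
def weight (p : ℕ × ℕ × ℕ) : ℕ ×ₗ ℕ ×ₗ ℕ :=
  toLex (p.1 + p.2.1 + p.2.2, toLex (p.1, p.2.1))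

lemma weight_add (p q : ℕ × ℕ × ℕ) : weight (p + q) = weight p + weight q := by
  simp only [weight, ← toLex_add, Prod.fst_add, Prod.snd_add, Prod.mk_add_mk]
  congr 2
  omega

lemma weight_injective : Function.Injective weight := by
  rintro ⟨a, b, c⟩ ⟨a', b', c'⟩ h
  simp only [weight, EmbeddingLike.apply_eq_iff_eq, Prod.mk.injEq] at h ⊢
  omega

lemma size_le_of_weight_le {p q : ℕ × ℕ × ℕ} (h : weight p ≤ weight q) :
    p.1 + p.2.1 + p.2.2 ≤ q.1 + q.2.1 + q.2.2 := by
  rcases Prod.Lex.toLex_le_toLex.mp h with h | h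
  · exact h.le
  · exact h.1.le

variable {Γ : Type*} [AddCommGroup Γ] (φ : ℕ × ℕ × ℕ →+ Γ)

/-- `p` is the least exponent triple representing the element `φ p`. -/
def IsReduced (p : ℕ × ℕ × ℕ) : Prop := ∀ q, φ q = φ p → weight p ≤ weight q

lemma exists_isReduced (p : ℕ × ℕ × ℕ) : ∃ q, IsReduced φ q ∧ φ q = φ p := by
  obtain ⟨q, hq, hmin⟩ := (InvImage.wf weight wellFounded_lt).has_min {q | φ q = φ p} ⟨p, rfl⟩
  exact ⟨q, fun q' hq' => not_lt.mp (hmin q' (hq'.trans hq)), hq⟩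

variable {φ}

lemma IsReduced.eq {p q : ℕ × ℕ × ℕ} (hp : IsReduced φ p) (hq : IsReduced φ q) (h : φ p = φ q) :
    p = q :=
  weight_injective (le_antisymm (hp q h.symm) (hq p h))

lemma IsReduced.of_add {p r : ℕ × ℕ × ℕ} (h : IsReduced φ (p + r)) : IsReduced φ p := by
  intro q hq
  have := h (q + r) (by rw [map_add, map_add, hq])
  rwa [weight_add, weight_add, add_le_add_iff_right] at this

lemma IsReduced.mono {p q : ℕ × ℕ × ℕ} (hq : IsReduced φ q) (h : p ≤ q) : IsReduced φ p := by
  obtain ⟨r, rfl⟩ := exists_add_of_le h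
  exact hq.of_add

lemma IsReduced.eq_of_map_add_eq {p q r : ℕ × ℕ × ℕ} (hp : IsReduced φ p) (hq : IsReduced φ q)
    (h : φ (p + r) = φ (q + r)) : p = q :=
  hp.eq hq (by simpa using h)

/-- A reduced triple equivalent to the non-reduced triple `p + r`, with `p` reduced, does not
dominate `r`. -/
lemma not_le_of_isReduced {p q r : ℕ × ℕ × ℕ} (hp : IsReduced φ p) (hpr : ¬ IsReduced φ (p + r))
    (hq : IsReduced φ q) (h : φ q = φ (p + r)) : ¬ r ≤ q := by
  intro hrq
  obtain ⟨s, rfl⟩ := exists_add_of_le hrq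
  rw [add_comm r s] at h hq
  rw [hq.of_add.eq_of_map_add_eq hp h] at hq
  exact hpr hq

variable (φ) in
/-- The number of reduced triples with first coordinate `x` and third coordinate `c`. -/
noncomputable def height (c x : ℕ) : ℕ := sInf {y | ¬ IsReduced φ (x, y, c)}

variable {k : ℕ}

lemma lt_height_iff (hk : ∀ p, IsReduced φ p → p.1 + p.2.1 + p.2.2 ≤ k) {x y c : ℕ} :
    y < height φ c x ↔ IsReduced φ (x, y, c) := by
  constructor
  · intro h
    by_contra hn
    exact Nat.notMem_of_lt_sInf h hn
  · intro h
    by_contra! hn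
    have hne : {y | ¬ IsReduced φ (x, y, c)}.Nonempty := by
      refine ⟨k + 1, fun h' => ?_⟩
      have := hk _ h'
      simp only at this
      omega
    exact Nat.sInf_mem hne (h.mono ⟨le_rfl, hn, le_rfl⟩)

lemma height_antitone_left (hk : ∀ p, IsReduced φ p → p.1 + p.2.1 + p.2.2 ≤ k) (x : ℕ) :
    Antitone fun c => height φ c x := by
  intro c c' h
  refine le_of_forall_lt fun y hy => ?_
  rw [lt_height_iff hk] at hy ⊢
  exact hy.mono ⟨le_rfl, le_rfl, h⟩

lemma height_antitone (hk : ∀ p, IsReduced φ p → p.1 + p.2.1 + p.2.2 ≤ k) (c : ℕ) :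
    Antitone (height φ c) := by
  intro x x' h
  refine le_of_forall_lt fun y hy => ?_
  rw [lt_height_iff hk] at hy ⊢
  exact hy.mono ⟨h, le_rfl, le_rfl⟩

lemma add_height_le (hk : ∀ p, IsReduced φ p → p.1 + p.2.1 + p.2.2 ≤ k) (c x : ℕ)
    (h : 0 < height φ c x) : c + x + height φ c x ≤ k + 1 := by
  have := hk _ ((lt_height_iff hk).mp (Nat.sub_one_lt_of_lt h))
  simp only at this
  omega

/-- The elements represented by the inner corners of the layers lie on the third axis. -/
lemma exists_isReduced_axis (hk : ∀ p, IsReduced φ p → p.1 + p.2.1 + p.2.2 ≤ k) {c x y c' m : ℕ}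
    (hx : x ∈ corners (height φ c) m) (hy : height φ c (x + 1) = y) (hc : c' ≤ c)
    (hcy : ¬ IsReduced φ (x + 1, y, c')) :
    ∃ r, IsReduced φ (0, 0, r) ∧ φ (0, 0, r) = φ ((x, y, c') + (1, 0, 0)) := by
  simp only [corners, mem_filter, hy] at hx
  obtain ⟨-, hpos, hlt⟩ := hx
  obtain ⟨y, rfl⟩ := Nat.exists_eq_succ_of_ne_zero hpos.ne'
  obtain ⟨⟨a, b, r⟩, hq, he⟩ := exists_isReduced φ ((x, y + 1, c') + (1, 0, 0))
  have h1 : IsReduced φ (x, y + 1, c') := ((lt_height_iff hk).mp hlt).mono ⟨le_rfl, le_rfl, hc⟩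
  have h2 : IsReduced φ (x + 1, y, c') :=
    ((lt_height_iff hk).mp (by omega : y < height φ c (x + 1))).mono ⟨le_rfl, le_rfl, hc⟩
  have ha := not_le_of_isReduced (r := (1, 0, 0)) h1 hcy hq he
  have hb := not_le_of_isReduced (r := (0, 1, 0)) h2 hcy hq he
  simp only [Prod.mk_le_mk, zero_le, and_true, true_and, not_le, Nat.lt_one_iff] at ha hb
  subst ha hb
  exact ⟨r, hq, he⟩

lemma sum_card_corners_le (hk : ∀ p, IsReduced φ p → p.1 + p.2.1 + p.2.2 ≤ k) (m n : ℕ) :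
    ∑ c ∈ range n, #(corners (height φ c) m) ≤ k + 1 := by
  rw [← card_sigma, ← card_range (k + 1)]
  refine card_le_card_of_forall_subsingleton
    (fun p r => φ (0, 0, r) = φ ((p.2, height φ p.1 (p.2 + 1), p.1) + (1, 0, 0))) ?_ ?_
  · rintro ⟨c, x⟩ hp
    obtain ⟨r, hr, he⟩ := exists_isReduced_axis hk (mem_sigma.mp hp).2 rfl le_rfl
      fun h => lt_irrefl _ ((lt_height_iff hk).mpr h)
    have := hk _ hr
    exact ⟨r, mem_range.mpr (by simp only at this; omega), he⟩
  · rintro r - ⟨c, x⟩ ⟨h, he⟩ ⟨c', x'⟩ ⟨h', he'⟩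
    simp only [corners, mem_sigma, mem_filter] at h h'
    have heq := IsReduced.eq_of_map_add_eq ((lt_height_iff hk).mp h.2.2.2)
      ((lt_height_iff hk).mp h'.2.2.2) (he.symm.trans he')
    simp only [Prod.mk.injEq] at heq
    obtain ⟨rfl, -, rfl⟩ := heq
    rfl

/-- A corner that does not lie on the wall of the bottom layer yields a relation. -/
lemma exists_isReduced_map_eq_zero (hk : ∀ p, IsReduced φ p → p.1 + p.2.1 + p.2.2 ≤ k)
    {c x m : ℕ} (hx : x ∈ corners (height φ c) m)
    (hne : height φ c (x + 1) ≠ height φ 0 (x + 1)) :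
    ∃ c', IsReduced φ (x, height φ c (x + 1), c') ∧
      φ ((x, height φ c (x + 1), c') + (1, 0, 0)) = 0 := by
  classical
  obtain ⟨y, hy⟩ : ∃ y, height φ c (x + 1) = y := ⟨_, rfl⟩
  have hc : ¬ IsReduced φ (x + 1, y, c) := fun h => hy.not_gt ((lt_height_iff hk).mpr h)
  have h0 : IsReduced φ (x + 1, y, 0) :=
    (lt_height_iff hk).mp (hy ▸ lt_of_le_of_ne (height_antitone_left hk _ (Nat.zero_le c)) hne)
  have hex : ∃ c', ¬ IsReduced φ (x + 1, y, c') := ⟨c, hc⟩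
  obtain ⟨c₀, hc₀⟩ : ∃ c₀, Nat.find hex = c₀ + 1 :=
    Nat.exists_eq_succ_of_ne_zero fun h => (h ▸ Nat.find_spec hex) h0
  have hred : IsReduced φ (x + 1, y, c₀) := not_not.mp (Nat.find_min hex (by omega))
  have hnot : ¬ IsReduced φ (x + 1, y, c₀ + 1) := hc₀ ▸ Nat.find_spec hex
  have hle : c₀ + 1 ≤ c := hc₀ ▸ Nat.find_min' hex hc
  obtain ⟨r, hr, he⟩ := exists_isReduced_axis hk hx hy hle hnot
  have hr0 := not_le_of_isReduced (r := (0, 0, 1)) hred hnot hr he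
  simp only [Prod.mk_le_mk, zero_le, true_and, not_le, Nat.lt_one_iff] at hr0
  subst hr0
  rw [hy]
  refine ⟨c₀ + 1, ?_, he ▸ map_zero φ⟩
  simp only [corners, mem_filter, hy] at hx
  exact ((lt_height_iff hk).mp hx.2.2).mono ⟨le_rfl, le_rfl, hle⟩

lemma card_le_sum_height [Fintype Γ] (hφ : Function.Surjective φ)
    (hk : ∀ p, IsReduced φ p → p.1 + p.2.1 + p.2.2 ≤ k) :
    Fintype.card Γ ≤ ∑ c ∈ range (k + 1), ∑ x ∈ range (k + 1), height φ c x := by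
  have hcard : ∑ c ∈ range (k + 1), ∑ x ∈ range (k + 1), height φ c x =
      #((range (k + 1)).sigma fun c => (range (k + 1)).sigma fun x => range (height φ c x)) := by
    simp only [card_sigma, card_range]
  rw [hcard, ← card_univ]
  refine card_le_card_of_surjOn (fun p => φ (p.2.1, p.2.2, p.1)) fun g _ => ?_
  obtain ⟨p, rfl⟩ := hφ g
  obtain ⟨⟨x, y, c⟩, hq, he⟩ := exists_isReduced φ p
  refine ⟨⟨c, x, y⟩, ?_, he⟩
  have := hk _ hq
  simp only [mem_coe, mem_sigma, mem_range, lt_height_iff hk] at this ⊢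
  exact ⟨by omega, by omega, hq⟩

/-- The density bound for a surjection whose reduced triples have bounded size. -/
lemma card_bound [Fintype Γ] (hφ : Function.Surjective φ)
    (hk : ∀ p, IsReduced φ p → p.1 + p.2.1 + p.2.2 ≤ k) :
    25 * Fintype.card Γ ≤ 3 * (k + 3) ^ 3 := by
  refine (Nat.mul_le_mul_left 25 (card_le_sum_height hφ hk)).trans
    (volume_le k (height φ) (height_antitone hk) (height_antitone_left hk) (add_height_le hk)
      (sum_card_corners_le hk _ _) ?_)
  intro c c' x x' hx hx' hne hne'
  obtain ⟨z, hz, he⟩ := exists_isReduced_map_eq_zero hk hx hne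
  obtain ⟨z', hz', he'⟩ := exists_isReduced_map_eq_zero hk hx' hne'
  have heq := hz.eq_of_map_add_eq hz' (he.trans he'.symm)
  simp only [Prod.mk.injEq] at heq
  exact ⟨heq.1, heq.2.1⟩

end AbelianCayley

/-- Fiduccia–Forcade–Zito, `Δ₃ ≤ 3/25`: if every element of a finite
abelian group `Γ` of order `N` is a nonnegative combination `a₁γ₁ + a₂γ₂ + a₃γ₃` with
`a₁ + a₂ + a₃ ≤ k`, then `25N ≤ 3(k+3)³`, i.e. the density of any Abelian Cayley
digraph of degree `3` is at most `3/25`. -/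
theorem density_degree_three_le (Γ : Type*) [AddCommGroup Γ] [Fintype Γ]
    (γ₁ γ₂ γ₃ : Γ) (k : ℕ)
    (h : ∀ g : Γ, ∃ a₁ a₂ a₃ : ℕ, g = a₁ • γ₁ + a₂ • γ₂ + a₃ • γ₃ ∧ a₁ + a₂ + a₃ ≤ k) :
    25 * Fintype.card Γ ≤ 3 * (k + 3)^3 := by
  let φ : ℕ × ℕ × ℕ →+ Γ :=
    (multiplesHom Γ γ₁).coprod ((multiplesHom Γ γ₂).coprod (multiplesHom Γ γ₃))
  have hφ : ∀ a b c : ℕ, φ (a, b, c) = a • γ₁ + b • γ₂ + c • γ₃ := fun a b c => by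
    simp [φ, add_assoc]
  refine AbelianCayley.card_bound (φ := φ) (fun g => ?_) fun p hp => ?_
  · obtain ⟨a, b, c, hg, -⟩ := h g
    exact ⟨(a, b, c), (hφ a b c).trans hg.symm⟩
  · obtain ⟨a, b, c, hg, hle⟩ := h (φ p)
    exact (AbelianCayley.size_le_of_weight_le
      (hp (a, b, c) ((hφ a b c).trans hg.symm))).trans hle
end
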